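/- There exist absolute constants c > 0 and C > 0 such that the following holds. Let F be a field, let A ⊆ F be a finite set with |A| = a, and let L be a finite set of n non-vertical lines in F^2 with a ≤ n; for each ℓ ∈ L write ℓ = {(x,y) ∈ F^2 : y = s_ℓ·x + t_ℓ}, and assume the pairs (s_ℓ, t_ℓ) are pairwise distinct. Assume that at most a^{1/2} n^{1/2} lines of L pass through any common point, and that at most a^{1/2} n^{1/2} lines of L share any common slope s_ℓ. If F has positive characteristic p, assume a·n ≤ c · p^2. Then the number of quadruples (x, ℓ, x', ℓ') ∈ A × L × A × L satisfying x·s_ℓ + t_ℓ = x'·s_{ℓ'} + t_{ℓ'} is at most C · a^{3/2} n^{3/2}. -/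

import Mathlib

open scoped Classical

namespace LineIncidence

open MvPolynomial

variable {F : Type*} [Field F]

/-- The point with parameter `τ` on the line with data `q = (c, s, t)` and free coordinate `i`:
coordinate `0` is `s τ + t`, coordinate `i` is `τ`, and the remaining coordinate is `c`. -/
def linePt (i : Fin 3) (q : F × F × F) (τ : F) : Fin 3 → F :=
  fun a => if a = 0 then q.2.1 * τ + q.2.2 else if a = i then τ else q.1

/-- The polynomial parametrization of the line described in `linePt`. -/
noncomputable def linePoly (i : Fin 3) (q : F × F × F) : Fin 3 → Polynomial F :=
  fun a => if a = 0 then Polynomial.C q.2.1 * Polynomial.X + Polynomial.C q.2.2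
    else if a = i then Polynomial.X else Polynomial.C q.1

/-- The line described in `linePt` lies on the surface `f = 0`. -/
def OnSurf (i : Fin 3) (q : F × F × F) (f : MvPolynomial (Fin 3) F) : Prop :=
  aeval (linePoly i q) f = 0

/-- The line with data `l` and free coordinate `2` meets the line with data `m` and
free coordinate `1`. -/
def Inc (l m : F × F × F) : Prop := l.2.1 * m.1 + l.2.2 = m.2.1 * l.1 + m.2.2

lemma Inc.symm {l m : F × F × F} (h : Inc l m) : Inc m l := Eq.symm h

lemma linePt_eq_linePt {i j : Fin 3} (hi : i ≠ 0) (hj : j ≠ 0) (hij : i ≠ j) {l m : F × F × F}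
    (h : Inc l m) : linePt i l m.1 = linePt j m l.1 := by
  funext a
  unfold linePt
  by_cases ha : a = 0
  · simp [ha]; exact h
  · by_cases hai : a = i
    · subst hai; simp [ha, hij]
    · have : a = j := by omega
      subst this; simp [ha, hai]

lemma inc_of_linePt_eq {i j : Fin 3} {l m : F × F × F}
    (h : linePt i l m.1 = linePt j m l.1) : Inc l m := by
  have := congrFun h 0
  simpa [linePt, Inc] using this

lemma eval_aeval_polynomial {σ : Type*} (γ : σ → Polynomial F) (f : MvPolynomial σ F) (τ : F) :
    (aeval γ f).eval τ = eval (fun a => (γ a).eval τ) f := by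
  rw [aeval_def, polynomial_eval_eval₂, ← eval₂_id]
  congr 1
  ext; simp

lemma eval_aeval_linePoly (i : Fin 3) (q : F × F × F) (f : MvPolynomial (Fin 3) F) (τ : F) :
    (aeval (linePoly i q) f).eval τ = eval (linePt i q τ) f := by
  rw [eval_aeval_polynomial]
  congr 2
  funext a
  simp only [linePoly, linePt]
  split_ifs <;> simp

lemma OnSurf.eval_eq_zero {i : Fin 3} {q : F × F × F} {f : MvPolynomial (Fin 3) F}
    (h : OnSurf i q f) (τ : F) : eval (linePt i q τ) f = 0 := by
  rw [← eval_aeval_linePoly, h]; simp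

lemma onSurf_of_eval [Infinite F] {i : Fin 3} {q : F × F × F} {f : MvPolynomial (Fin 3) F}
    (h : ∀ τ, eval (linePt i q τ) f = 0) : OnSurf i q f :=
  Polynomial.funext fun τ => by rw [eval_aeval_linePoly, h]; simp

lemma onSurf_mul {i : Fin 3} {q : F × F × F} {f g : MvPolynomial (Fin 3) F} :
    OnSurf i q (f * g) ↔ OnSurf i q f ∨ OnSurf i q g := by
  simp [OnSurf]

lemma natDegree_aeval_linePoly (i : Fin 3) (q : F × F × F) (f : MvPolynomial (Fin 3) F) :
    (aeval (linePoly i q) f).natDegree ≤ f.totalDegree := by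
  have := aeval_natDegree_le f le_rfl (linePoly i q) (n := 1) (fun a => by
    unfold linePoly
    split_ifs
    · exact Polynomial.natDegree_linear_le
    · exact Polynomial.natDegree_X_le
    · simp)
  simpa using this

/-- A nonzero univariate polynomial vanishes on few elements of a finite set. -/
lemma card_le_of_eval_eq_zero {K : Type*} [Field K] {g : Polynomial K} (hg : g ≠ 0) {S : Finset K}
    (h : ∀ x ∈ S, g.eval x = 0) : S.card ≤ g.natDegree :=
  Polynomial.card_le_degree_of_subset_roots (p := g) (Z := S) (by
    intro x hx
    rw [Polynomial.mem_roots hg]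
    exact h x (by simpa using hx))

lemma card_le_of_not_onSurf {i : Fin 3} {q : F × F × F} {f : MvPolynomial (Fin 3) F}
    (h : ¬ OnSurf i q f) {S : Finset F} (hS : ∀ τ ∈ S, eval (linePt i q τ) f = 0) :
    S.card ≤ f.totalDegree :=
  (card_le_of_eval_eq_zero h fun τ hτ => by
    rw [eval_aeval_linePoly]; exact hS τ hτ).trans (natDegree_aeval_linePoly i q f)

/-- A line not on a surface meets few of the pairwise skew lines on that surface. -/
lemma card_inc_le {i j : Fin 3} (hi : i ≠ 0) (hj : j ≠ 0) (hij : i ≠ j)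
    {f : MvPolynomial (Fin 3) F} {m : F × F × F} (hm : ¬ OnSurf j m f)
    {L : Finset (F × F × F)} (hinj : Set.InjOn Prod.fst (L : Set (F × F × F)))
    (hL : ∀ l ∈ L, OnSurf i l f) : (L.filter fun l => Inc l m).card ≤ f.totalDegree := by
  rw [← Finset.card_image_of_injOn (f := Prod.fst)
    (hinj.mono (Finset.coe_subset.2 (Finset.filter_subset _ L)))]
  refine card_le_of_not_onSurf hm ?_
  intro τ hτ
  obtain ⟨l, hl, rfl⟩ := Finset.mem_image.1 hτ
  rw [Finset.mem_filter] at hl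
  rw [← linePt_eq_linePt hi hj hij hl.2]
  exact (hL l hl.1).eval_eq_zero _

lemma totalDegree_pderiv_le (i : Fin 3) (f : MvPolynomial (Fin 3) F) :
    (pderiv i f).totalDegree ≤ f.totalDegree := by
  conv_lhs => rw [f.as_sum, map_sum]
  refine totalDegree_finsetSum_le fun s hs => ?_
  rw [pderiv_monomial]
  refine (totalDegree_monomial_le _ _).trans (le_trans ?_ (le_totalDegree hs))
  exact Finsupp.degree_mono tsub_le_self

lemma resultant_ne_zero_of_prime {R : Type*} [CommRing R] [IsDomain R] {f g : Polynomial R}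
    (hf : Prime f) (hfg : ¬ f ∣ g) : f.resultant g f.natDegree g.natDegree ≠ 0 := by
  intro h
  let b₁ := ((Polynomial.degreeLT.basis R f.natDegree).prod
    (Polynomial.degreeLT.basis R g.natDegree)).reindex finSumFinEquiv
  let b₂ := Polynomial.degreeLT.basis R (f.natDegree + g.natDegree)
  rw [Polynomial.resultant, ← Polynomial.toMatrix_sylvesterMap' f g le_rfl le_rfl,
    ← Matrix.exists_mulVec_eq_zero_iff] at h
  obtain ⟨v, hv, hv0⟩ := h
  obtain ⟨x, rfl⟩ := b₁.equivFun.surjective v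
  have h1 : Polynomial.sylvesterMap f g le_rfl le_rfl x = 0 := by
    apply b₂.equivFun.injective
    rw [map_zero]
    exact (LinearMap.toMatrix_mulVec_repr b₁ b₂ _ x).symm.trans hv0
  have h2 : f * (x.2 : Polynomial R) + g * (x.1 : Polynomial R) = 0 := congrArg Subtype.val h1
  have h3 : f ∣ g * (x.1 : Polynomial R) := ⟨-x.2, by linear_combination h2⟩
  have h4 := (hf.dvd_or_dvd h3).resolve_left hfg
  have h5 : (x.1 : Polynomial R) = 0 := by
    by_contra h0
    have hd := Polynomial.mem_degreeLT.1 x.1.2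
    rw [Polynomial.degree_eq_natDegree h0] at hd
    have := Polynomial.natDegree_le_of_dvd h4 h0
    have hd' : (x.1 : Polynomial R).natDegree < f.natDegree := by exact_mod_cast hd
    omega
  have h6 : (x.2 : Polynomial R) = 0 := by
    rw [h5, mul_zero, add_zero] at h2
    exact (mul_eq_zero.1 h2).resolve_left hf.ne_zero
  apply hv
  have : x = 0 := Prod.ext (Subtype.ext h5) (Subtype.ext h6)
  rw [this, map_zero]

lemma totalDegree_coeff_finSuccEquiv_le (f : MvPolynomial (Fin 3) F) (n : ℕ) :
    ((finSuccEquiv F 2 f).coeff n).totalDegree ≤ f.totalDegree := by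
  by_cases h : (finSuccEquiv F 2 f).coeff n = 0
  · simp [h]
  · have := totalDegree_coeff_finSuccEquiv_add_le f n h
    omega

lemma natDegree_finSuccEquiv_le (f : MvPolynomial (Fin 3) F) :
    (finSuccEquiv F 2 f).natDegree ≤ f.totalDegree := by
  rw [natDegree_finSuccEquiv]
  exact degreeOf_le_totalDegree f 0

lemma totalDegree_resultant_le (f g : MvPolynomial (Fin 3) F) :
    ((finSuccEquiv F 2 f).resultant (finSuccEquiv F 2 g) (finSuccEquiv F 2 f).natDegree
      (finSuccEquiv F 2 g).natDegree).totalDegree ≤ 2 * f.totalDegree * g.totalDegree := by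
  have hm := natDegree_finSuccEquiv_le f
  have hn := natDegree_finSuccEquiv_le g
  set m := (finSuccEquiv F 2 f).natDegree
  set n := (finSuccEquiv F 2 g).natDegree
  rw [Polynomial.resultant, Matrix.det_apply]
  refine totalDegree_finsetSum_le fun σ _ => ?_
  refine (totalDegree_smul_le _ _).trans ((totalDegree_finsetProd _ _).trans ?_)
  rw [Fin.sum_univ_add]
  have h1 : ∀ j : Fin m, (((finSuccEquiv F 2 f).sylvester (finSuccEquiv F 2 g) m n)
      (σ (Fin.castAdd n j)) (Fin.castAdd n j)).totalDegree ≤ g.totalDegree := by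
    intro j
    rw [Polynomial.sylvester, Matrix.of_apply, Fin.addCases_left]
    split_ifs
    · exact totalDegree_coeff_finSuccEquiv_le _ _
    · simp
  have h2 : ∀ j : Fin n, (((finSuccEquiv F 2 f).sylvester (finSuccEquiv F 2 g) m n)
      (σ (Fin.natAdd m j)) (Fin.natAdd m j)).totalDegree ≤ f.totalDegree := by
    intro j
    rw [Polynomial.sylvester, Matrix.of_apply, Fin.addCases_right]
    split_ifs
    · exact totalDegree_coeff_finSuccEquiv_le _ _
    · simp
  have h3 := Finset.sum_le_card_nsmul Finset.univ _ _ (fun j _ => h1 j)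
  have h4 := Finset.sum_le_card_nsmul Finset.univ _ _ (fun j _ => h2 j)
  simp only [Finset.card_univ, Fintype.card_fin, smul_eq_mul] at h3 h4
  nlinarith

lemma eval_eq_eval_finSuccEquiv (f : MvPolynomial (Fin 3) F) (x : Fin 3 → F) :
    eval x f = eval (x ∘ Fin.succ) (Polynomial.eval (C (x 0)) (finSuccEquiv F 2 f)) := by
  rw [eval_polynomial_eval_finSuccEquiv]
  congr 2
  funext a
  refine Fin.cases ?_ (fun b => ?_) a <;> simp

/-- Eliminating the coordinate `0` from two equations without common component. -/
lemma exists_elimination {f g : MvPolynomial (Fin 3) F} (hf : Prime f) (hd : f.degreeOf 0 ≠ 0)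
    (hfg : ¬ f ∣ g) : ∃ H : MvPolynomial (Fin 2) F, H ≠ 0 ∧
      H.totalDegree ≤ 2 * f.totalDegree * g.totalDegree ∧
      ∀ x : Fin 3 → F, eval x f = 0 → eval x g = 0 → eval (x ∘ Fin.succ) H = 0 := by
  refine ⟨_, resultant_ne_zero_of_prime (f := finSuccEquiv F 2 f) (g := finSuccEquiv F 2 g)
    ?_ ?_, totalDegree_resultant_le f g, ?_⟩
  · exact (MulEquiv.prime_iff (finSuccEquiv F 2).toMulEquiv).2 hf
  · rwa [map_dvd_iff]
  · intro x hx hx'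
    obtain ⟨p, q, -, -, h⟩ := Polynomial.exists_mul_add_mul_eq_C_resultant
      (finSuccEquiv F 2 f) (finSuccEquiv F 2 g) le_rfl le_rfl
      (Or.inl (by rwa [natDegree_finSuccEquiv]))
    have := congrArg (fun P => eval (x ∘ Fin.succ) (Polynomial.eval (C (x 0)) P)) h
    simp only [Polynomial.eval_add, Polynomial.eval_mul, map_add, map_mul, Polynomial.eval_C,
      ← eval_eq_eval_finSuccEquiv, hx, hx'] at this
    simpa using this.symm

/-- Few pairwise skew lines lie on two surfaces without common component. -/
lemma card_le_of_onSurf_of_onSurf [Infinite F] {f g : MvPolynomial (Fin 3) F} (hf : Prime f)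
    (hd : f.degreeOf 0 ≠ 0) (hfg : ¬ f ∣ g) {i : Fin 3} (hi : i ≠ 0) {S : Finset (F × F × F)}
    (hinj : Set.InjOn Prod.fst (S : Set (F × F × F))) (hSf : ∀ q ∈ S, OnSurf i q f)
    (hSg : ∀ q ∈ S, OnSurf i q g) : S.card ≤ 2 * f.totalDegree * g.totalDegree := by
  obtain ⟨H, hH, hHd, hHv⟩ := exists_elimination hf hd hfg
  obtain ⟨w, hw⟩ : ∃ w, eval w H ≠ 0 := by
    by_contra! h
    exact hH (funext fun w => by simp [h w])
  obtain ⟨i', rfl⟩ := Fin.exists_succ_eq.2 hi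
  let γ : Fin 2 → Polynomial F := fun a => if a = i' then Polynomial.C (w i') else Polynomial.X
  have hev : ∀ y, (aeval γ H).eval y = eval (fun a => if a = i' then w i' else y) H := by
    intro y
    rw [eval_aeval_polynomial]
    congr 2
    funext a
    simp only [γ]
    split_ifs <;> simp
  have hne : aeval γ H ≠ 0 := by
    intro h0
    apply hw
    have h1 := hev (w (1 - i'))
    rw [h0, Polynomial.eval_zero] at h1
    rw [h1]
    congr 2
    funext a
    split_ifs with h
    · rw [h]
    · congr 1; omega
  have hdeg : (aeval γ H).natDegree ≤ H.totalDegree * 1 := by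
    refine aeval_natDegree_le H le_rfl γ fun a => ?_
    simp only [γ]
    split_ifs <;> simp
  rw [← Finset.card_image_of_injOn hinj]
  refine (card_le_of_eval_eq_zero hne ?_).trans (by omega)
  intro y hy
  obtain ⟨q, hq, rfl⟩ := Finset.mem_image.1 hy
  rw [hev]
  have := hHv (linePt i'.succ q (w i')) ((hSf q hq).eval_eq_zero _) ((hSg q hq).eval_eq_zero _)
  rw [← this]
  congr 2
  funext a
  simp [linePt, Fin.succ_inj]

/-- The chain rule for a derivation applied to a polynomial expression. -/
lemma derivation_aeval {A : Type*} [CommRing A] [Algebra F A] (δ : Derivation F A A)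
    (γ : Fin 3 → A) (f : MvPolynomial (Fin 3) F) :
    δ (aeval γ f) = ∑ a, aeval γ (pderiv a f) * δ (γ a) := by
  induction f using MvPolynomial.induction_on with
  | C r => simp
  | add p q hp hq => simp only [map_add, hp, hq, add_mul, Finset.sum_add_distrib]
  | mul_X p b hp =>
    simp only [map_mul, Derivation.leibniz, hp, aeval_X, smul_eq_mul, map_add, add_mul,
      Finset.sum_add_distrib, pderiv_X]
    congr 1
    · rw [Finset.sum_eq_single b]
      · simp
      · intro a _ ha; simp [ha.symm]
      · simp
    · rw [Finset.mul_sum]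
      exact Finset.sum_congr rfl fun a _ => by ring

lemma map_aeval_of_map_algebraMap {A B : Type*} [CommRing A] [Algebra F A] [CommRing B]
    [Algebra F B] (φ : A →+* B) (h : ∀ r, φ (algebraMap F A r) = algebraMap F B r)
    (γ : Fin 3 → A) (f : MvPolynomial (Fin 3) F) :
    φ (aeval γ f) = aeval (fun a => φ (γ a)) f := by
  induction f using MvPolynomial.induction_on with
  | C r => simp [h]
  | add p q hp hq => simp only [map_add, hp, hq]
  | mul_X p b hp => simp only [map_mul, hp, aeval_X]

/-- Up to sign, the second derivative (with denominators cleared) of the coordinate `0` as an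
implicit function of the coordinate `i` on the surface `f = 0`. -/
noncomputable def flex (i : Fin 3) (f : MvPolynomial (Fin 3) F) : MvPolynomial (Fin 3) F :=
  pderiv i (pderiv i f) * pderiv 0 f * pderiv 0 f
    - (pderiv 0 (pderiv i f) + pderiv i (pderiv 0 f)) * pderiv i f * pderiv 0 f
    + pderiv 0 (pderiv 0 f) * pderiv i f * pderiv i f

lemma totalDegree_flex_le (i : Fin 3) (f : MvPolynomial (Fin 3) F) :
    (flex i f).totalDegree ≤ 3 * f.totalDegree := by
  have h1 (a : Fin 3) := totalDegree_pderiv_le a f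
  have h2 (a b : Fin 3) : (pderiv a (pderiv b f)).totalDegree ≤ f.totalDegree :=
    (totalDegree_pderiv_le a _).trans (h1 b)
  have key (p : MvPolynomial (Fin 3) F) (hp : p.totalDegree ≤ f.totalDegree) (a b : Fin 3) :
      (p * pderiv a f * pderiv b f).totalDegree ≤ 3 * f.totalDegree := by
    have e1 := totalDegree_mul (p * pderiv a f) (pderiv b f)
    have e2 := totalDegree_mul p (pderiv a f)
    have := h1 a
    have := h1 b
    omega
  unfold flex
  refine (totalDegree_add _ _).trans (max_le ((totalDegree_sub _ _).trans (max_le ?_ ?_)) ?_)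
  · exact key _ (h2 _ _) _ _
  · exact key _ ((totalDegree_add _ _).trans (max_le (h2 _ _) (h2 _ _))) _ _
  · exact key _ (h2 _ _) _ _

lemma derivative_aeval_linePoly {i : Fin 3} (hi : i ≠ 0) (q : F × F × F)
    (f : MvPolynomial (Fin 3) F) :
    Polynomial.derivative (aeval (linePoly i q) f) =
      aeval (linePoly i q) (pderiv 0 f) * Polynomial.C q.2.1 +
        aeval (linePoly i q) (pderiv i f) := by
  have := derivation_aeval (F := F) Polynomial.derivative' (linePoly i q) f
  rw [show Polynomial.derivative (aeval (linePoly i q) f) =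
    Polynomial.derivative' (aeval (linePoly i q) f) from rfl, this, Fin.sum_univ_three]
  obtain rfl | rfl : i = 1 ∨ i = 2 := by omega
  all_goals simp [linePoly, Polynomial.derivative']

lemma OnSurf.flex {i : Fin 3} (hi : i ≠ 0) {q : F × F × F} {f : MvPolynomial (Fin 3) F}
    (h : OnSurf i q f) : OnSurf i q (flex i f) := by
  have h1 := derivative_aeval_linePoly hi q f
  have h2 := congrArg Polynomial.derivative h1
  rw [h, Polynomial.derivative_zero] at h1
  rw [h, Polynomial.derivative_zero, Polynomial.derivative_zero, Polynomial.derivative_add,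
    Polynomial.derivative_mul, Polynomial.derivative_C, mul_zero, add_zero,
    derivative_aeval_linePoly hi, derivative_aeval_linePoly hi] at h2
  unfold OnSurf LineIncidence.flex
  simp only [map_add, map_sub, map_mul]
  have h3 : aeval (linePoly i q) (pderiv i f) =
    - (aeval (linePoly i q) (pderiv 0 f) * Polynomial.C q.2.1) := by linear_combination -h1
  rw [h3]
  linear_combination (-(aeval (linePoly i q) (pderiv 0 f)) ^ 2) * h2

/-- The direction field tangent to the surfaces `f = const` in which the coordinates other than
`0` and `i` are constant. -/
noncomputable def tangentDeriv (i : Fin 3) (f : MvPolynomial (Fin 3) F) :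
    Derivation F (MvPolynomial (Fin 3) F) (MvPolynomial (Fin 3) F) :=
  pderiv 0 f • pderiv i - pderiv i f • pderiv 0

/-- The generic tangent line in the direction of `tangentDeriv i f`. -/
noncomputable def tangentLine (i : Fin 3) (f : MvPolynomial (Fin 3) F) :
    Fin 3 → Polynomial (MvPolynomial (Fin 3) F) :=
  fun a => Polynomial.C (X a) + Polynomial.C (if a = 0 then - pderiv i f
    else if a = i then pderiv 0 f else 0) * Polynomial.X

lemma dvd_coeff_tangentLine {i : Fin 3} (hi : i ≠ 0) {f : MvPolynomial (Fin 3) F} (hf : Prime f)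
    (h0 : ¬ f ∣ pderiv 0 f) (hflex : f ∣ flex i f)
    (hchar : ∀ j : ℕ, 0 < j → j ≤ f.totalDegree → (j : F) ≠ 0) (n : ℕ) (hn : n ≤ f.totalDegree) :
    f ∣ (aeval (tangentLine i f) f).coeff n := by
  let D := tangentDeriv i f
  let E : Derivation F (Polynomial (MvPolynomial (Fin 3) F))
      (Polynomial (MvPolynomial (Fin 3) F)) :=
    PolynomialModule.equivPolynomialSelf.compDer D.mapCoeffs
  have hEc : ∀ P n, (E P).coeff n = D (P.coeff n) := fun P n => rfl
  have hEC : ∀ r, E (Polynomial.C r) = Polynomial.C (D r) := by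
    intro r
    ext1 n
    rw [hEc, Polynomial.coeff_C, Polynomial.coeff_C]
    split_ifs <;> simp
  have hEX : E Polynomial.X = 0 := by
    ext1 n
    rw [hEc, Polynomial.coeff_X]
    split_ifs <;> simp
  obtain ⟨w, hw⟩ := hflex
  have hDf : D f = 0 := by simp [D, tangentDeriv]; ring
  have key : ∃ W, Polynomial.C (pderiv 0 f) * E (aeval (tangentLine i f) f) =
      (Polynomial.C (pderiv 0 f) + Polynomial.C (D (pderiv 0 f)) * Polynomial.X) *
        Polynomial.derivative (aeval (tangentLine i f) f) + Polynomial.C f * W := by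
    have e1 := derivation_aeval E (tangentLine i f) f
    have e2 := derivation_aeval (Polynomial.derivative'.restrictScalars F) (tangentLine i f) f
    change Polynomial.derivative _ = _ at e2
    have e3 : pderiv 0 f * D (- pderiv i f) - (- pderiv i f) * D (pderiv 0 f) = - f * w := by
      have hw' : - f * w = - flex i f := by rw [hw]; ring
      rw [hw']
      simp only [D, tangentDeriv, Derivation.coe_sub, Derivation.coe_smul, Pi.sub_apply,
        Pi.smul_apply, smul_eq_mul, map_neg, LineIncidence.flex]
      ring
    have e3' := congrArg (Polynomial.C : _ → Polynomial (MvPolynomial (Fin 3) F)) e3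
    simp only [map_sub, map_mul, map_neg] at e3'
    refine ⟨- Polynomial.C w * Polynomial.X * aeval (tangentLine i f) (pderiv 0 f), ?_⟩
    rw [e1, e2, Fin.sum_univ_three, Fin.sum_univ_three]
    have hX : ∀ a, E (tangentLine i f a) = Polynomial.C (D (X a)) +
        Polynomial.C (D (if a = 0 then - pderiv i f else if a = i then pderiv 0 f else 0)) *
          Polynomial.X := by
      intro a
      simp only [tangentLine, map_add, Derivation.leibniz, hEC, hEX, smul_eq_mul]
      ring
    have hT : ∀ a, Polynomial.derivative'.restrictScalars F (tangentLine i f a) =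
        Polynomial.C (if a = 0 then - pderiv i f else if a = i then pderiv 0 f else 0) := by
      intro a
      change Polynomial.derivative _ = _
      simp [tangentLine]
    simp only [hX, hT]
    have hDX : ∀ a, D (X a) = if a = 0 then - pderiv i f else if a = i then pderiv 0 f else 0 := by
      intro a
      simp only [D, tangentDeriv, Derivation.coe_sub, Derivation.coe_smul, Pi.sub_apply,
        Pi.smul_apply, smul_eq_mul, pderiv_X, Pi.single_apply]
      by_cases ha : a = 0
      · subst ha; simp [hi.symm]
      · by_cases hai : a = i
        · subst hai; simp [ha]
        · simp [ha, hai]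
    simp only [hDX]
    obtain rfl | rfl : i = 1 ∨ i = 2 := by omega
    all_goals
      simp
      linear_combination (aeval (tangentLine _ f) (pderiv 0 f)) * Polynomial.X * e3'
  obtain ⟨W, hW⟩ := key
  induction n with
  | zero =>
    have : (aeval (tangentLine i f) f).coeff 0 = f := by
      rw [Polynomial.coeff_zero_eq_eval_zero, ← Polynomial.coe_evalRingHom]
      have : (Polynomial.evalRingHom 0) ((aeval (tangentLine i f)) f) = aeval X f := by
        rw [map_aeval_of_map_algebraMap _ (fun r => by simp)]
        congr 1
        congr 1
        funext a
        simp [tangentLine]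
      rw [this, aeval_X_left_apply]
    rw [this]
  | succ n ih =>
    have ih := ih (by omega)
    have hD : f ∣ D ((aeval (tangentLine i f) f).coeff n) := by
      obtain ⟨r, hr⟩ := ih
      rw [hr, Derivation.leibniz, hDf, smul_zero, add_zero]
      exact dvd_mul_right _ _
    have hc := congrArg (fun P => Polynomial.coeff P n) hW
    simp only [Polynomial.coeff_C_mul, Polynomial.coeff_add, add_mul, mul_assoc, hEc] at hc
    have hXc : f ∣ (Polynomial.X * Polynomial.derivative (aeval (tangentLine i f) f)).coeff n := by
      cases n with
      | zero => simp
      | succ n =>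
        rw [Polynomial.coeff_X_mul, Polynomial.coeff_derivative]
        exact ih.mul_right _
    have h1 : f ∣ pderiv 0 f * (Polynomial.derivative (aeval (tangentLine i f) f)).coeff n := by
      have := dvd_sub (dvd_sub (hD.mul_left (pderiv 0 f)) (hXc.mul_left (D (pderiv 0 f))))
        (dvd_mul_right f (W.coeff n))
      rw [hc] at this
      convert this using 1
      ring
    have h2 := (hf.dvd_or_dvd h1).resolve_left h0
    rw [Polynomial.coeff_derivative] at h2
    have h3 : IsUnit ((n : MvPolynomial (Fin 3) F) + 1) := by
      have : ((n : MvPolynomial (Fin 3) F) + 1) = C ((n + 1 : ℕ) : F) := by simp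
      rw [this]
      exact (isUnit_iff_ne_zero.2 (hchar (n + 1) (by omega) hn)).map C
    exact (h3.dvd_mul_right).1 h2

/-- If `f ∣ flex i f`, then through a smooth point of `f = 0` there is a line on `f = 0` with free
coordinate `i`. -/
lemma exists_onSurf_of_dvd_flex [Infinite F] {i j : Fin 3} (hi : i ≠ 0) (hj : j ≠ 0) (hij : i ≠ j)
    {f : MvPolynomial (Fin 3) F} (hf : Prime f)
    (h0 : ¬ f ∣ pderiv 0 f) (hflex : f ∣ flex i f)
    (hchar : ∀ j : ℕ, 0 < j → j ≤ f.totalDegree → (j : F) ≠ 0) {x : Fin 3 → F}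
    (hx : eval x f = 0) (hx0 : eval x (pderiv 0 f) ≠ 0) :
    ∃ q : F × F × F, q.1 = x j ∧ OnSurf i q f ∧ linePt i q (x i) = x := by
  let γ : Fin 3 → Polynomial F := fun a => (tangentLine i f a).map (eval x)
  have hγ : aeval γ f = (aeval (tangentLine i f) f).map (eval x) := by
    rw [← Polynomial.coe_mapRingHom, map_aeval_of_map_algebraMap _ (fun r => by simp)]
    rfl
  have hγd : ∀ a, (γ a).natDegree ≤ 1 := by
    intro a
    simp only [γ, tangentLine, Polynomial.map_add, Polynomial.map_mul, Polynomial.map_C,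
      Polynomial.map_X]
    rw [add_comm]
    exact Polynomial.natDegree_linear_le
  have hzero : aeval γ f = 0 := by
    ext n
    by_cases hn : n ≤ f.totalDegree
    · obtain ⟨r, hr⟩ := dvd_coeff_tangentLine hi hf h0 hflex hchar n hn
      rw [hγ, Polynomial.coeff_map, hr, map_mul, hx]
      simp
    · have := aeval_natDegree_le f le_rfl γ hγd
      rw [Polynomial.coeff_eq_zero_of_natDegree_lt (by omega)]
      simp
  set u := eval x (pderiv 0 f)
  set v := eval x (pderiv i f)
  refine ⟨(x j, - v / u, x 0 + v / u * x i), rfl, onSurf_of_eval fun τ => ?_, ?_⟩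
  · have h1 := eval_aeval_polynomial γ f ((τ - x i) / u)
    rw [hzero, Polynomial.eval_zero] at h1
    rw [h1]
    congr 2
    funext a
    simp only [γ, tangentLine, linePt]
    by_cases ha : a = 0
    · subst ha; simp [u, v]; ring
    · by_cases hai : a = i
      · subst hai; simp [ha]; change _ = x a + u * _; field_simp; ring
      · have : a = j := by omega
        subst this; simp [ha, hai]
  · funext a
    simp only [linePt]
    by_cases ha : a = 0
    · subst ha; simp; ring
    · by_cases hai : a = i
      · subst hai; simp [ha]
      · have : a = j := by omega
        subst this; simp [ha, hai]

/-- If a prime surface contains many lines meeting two skew lines, it is the graph of a bilinear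
polynomial. -/
lemma inc_of_card_lt [Infinite F] {f : MvPolynomial (Fin 3) F} (hf : Prime f)
    {m₁ m₂ : F × F × F} (hm : m₁.1 ≠ m₂.1) {L : Finset (F × F × F)}
    (hinj : Set.InjOn Prod.fst (L : Set (F × F × F))) (hL : ∀ l ∈ L, OnSurf 2 l f)
    (h₁ : ∀ l ∈ L, Inc l m₁) (h₂ : ∀ l ∈ L, Inc l m₂) (hcard : f.totalDegree < L.card)
    {l m : F × F × F} (hl : OnSurf 2 l f) (hmf : OnSurf 1 m f) : Inc l m := by
  have hm' : m₁.1 - m₂.1 ≠ 0 := sub_ne_zero.2 hm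
  let r : F → F × F × F := fun y => (y,
    m₁.2.1 + (y - m₁.1) * ((m₁.2.1 - m₂.2.1) / (m₁.1 - m₂.1)),
    m₁.2.2 + (y - m₁.1) * ((m₁.2.2 - m₂.2.2) / (m₁.1 - m₂.1)))
  have hr : ∀ y, OnSurf 1 (r y) f := by
    intro y
    by_contra h
    have := card_inc_le (i := 2) (j := 1) (by decide) (by decide) (by decide) h hinj hL
    rw [Finset.filter_true_of_mem] at this
    · omega
    · intro l hl
      have e1 := h₁ l hl
      have e2 := h₂ l hl
      unfold Inc at *
      simp only [r]
      field_simp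
      linear_combination (y - m₂.1) * e1 - (y - m₁.1) * e2
  let b : MvPolynomial (Fin 2) F :=
    (C m₁.2.1 + (X 1 - C m₁.1) * C ((m₁.2.1 - m₂.2.1) / (m₁.1 - m₂.1))) * X 0
    + (C m₁.2.2 + (X 1 - C m₁.1) * C ((m₁.2.2 - m₂.2.2) / (m₁.1 - m₂.1)))
  have hb : ∀ w, eval w b = (r (w 1)).2.1 * w 0 + (r (w 1)).2.2 := by
    intro w; simp [b, r]
  have hroot : Polynomial.eval b (finSuccEquiv F 2 f) = 0 := by
    refine funext fun w => ?_
    have h1 := (hr (w 1)).eval_eq_zero (w 0)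
    rw [eval_polynomial_eval_finSuccEquiv, map_zero, ← h1]
    congr 2
    funext a
    refine Fin.cases ?_ (fun c => ?_) a
    · simp [linePt, hb, r]
    · fin_cases c <;> simp [linePt, r] <;> rfl
  obtain ⟨u, hu⟩ := Polynomial.dvd_iff_isRoot.2 hroot
  have hirr : Irreducible (finSuccEquiv F 2 f) :=
    ((MulEquiv.prime_iff (finSuccEquiv F 2).toMulEquiv).2 hf).irreducible
  have hunit : IsUnit u :=
    (hirr.isUnit_or_isUnit hu).resolve_left (Polynomial.not_isUnit_X_sub_C b)
  have key : ∀ x : Fin 3 → F, eval x f = 0 → x 0 = eval (x ∘ Fin.succ) b := by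
    intro x hx
    rw [eval_eq_eval_finSuccEquiv, hu, Polynomial.eval_mul, map_mul] at hx
    have h1 : IsUnit (eval (x ∘ Fin.succ) (Polynomial.eval (C (x 0)) u)) :=
      (hunit.map (Polynomial.evalRingHom (C (x 0)))).map (eval (x ∘ Fin.succ))
    have h2 := (mul_eq_zero.1 hx).resolve_right h1.ne_zero
    simpa [sub_eq_zero] using h2
  have e1 := key _ (hl.eval_eq_zero m.1)
  have e2 := key _ (hmf.eval_eq_zero l.1)
  rw [hb] at e1 e2
  simp [linePt] at e1 e2
  exact e1.trans e2.symm

lemma exists_finset_eval_ne_zero {K : Type*} [Field K] [Infinite K] {P : Polynomial K} (hP : P ≠ 0)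
    (n : ℕ) : ∃ s : Finset K, s.card = n ∧ ∀ x ∈ s, P.eval x ≠ 0 := by
  have h : {x | P.eval x ≠ 0}.Infinite := by
    have : {x | P.eval x ≠ 0} = (P.roots.toFinset : Set K)ᶜ := by
      ext x; simp [hP]
    rw [this]
    exact P.roots.toFinset.finite_toSet.infinite_compl
  obtain ⟨s, hs, hn⟩ := h.exists_subset_card_eq n
  exact ⟨s, hn, fun x hx => hs hx⟩

lemma exists_eval_ne_zero {K : Type*} [Field K] [Infinite K] {P : Polynomial K} (hP : P ≠ 0) :
    ∃ x, P.eval x ≠ 0 := by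
  by_contra! h
  exact hP (Polynomial.funext fun x => by simp [h x])

/-- A prime surface that is doubly flexed along its two families is doubly ruled. -/
lemma inc_of_dvd_flex [Infinite F] {f : MvPolynomial (Fin 3) F} (hf : Prime f)
    (h0 : ¬ f ∣ pderiv 0 f) (hflex₁ : f ∣ flex 1 f) (hflex₂ : f ∣ flex 2 f)
    (hchar : ∀ j : ℕ, 0 < j → j ≤ f.totalDegree → (j : F) ≠ 0)
    {m₁ : F × F × F} (hm₁ : OnSurf 1 m₁ f) (hm₁' : ¬ OnSurf 1 m₁ (pderiv 0 f))
    {l m : F × F × F} (hl : OnSurf 2 l f) (hm : OnSurf 1 m f) : Inc l m := by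
  obtain ⟨s, hs, hs0⟩ := exists_finset_eval_ne_zero hm₁' (f.totalDegree * f.totalDegree + 1)
  have hex : ∀ x ∈ s, ∃ q : F × F × F, q.1 = x ∧ OnSurf 2 q f ∧
      linePt 2 q m₁.1 = linePt 1 m₁ x := by
    intro x hx
    have h1 := hs0 x hx
    rw [eval_aeval_linePoly] at h1
    obtain ⟨q, e1, e2, e3⟩ := exists_onSurf_of_dvd_flex (i := 2) (j := 1) (by decide) (by decide)
      (by decide) hf h0 hflex₂ hchar (hm₁.eval_eq_zero x) h1
    exact ⟨q, e1.trans (by simp [linePt]), e2, by simpa [linePt] using e3⟩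
  choose! q hq1 hqf hqp using hex
  obtain ⟨y, hy⟩ : ∃ y, ((∏ x ∈ s, aeval (linePoly 2 (q x)) (pderiv 0 f)) *
      (Polynomial.X - Polynomial.C m₁.1)).eval y ≠ 0 := by
    refine exists_eval_ne_zero (mul_ne_zero ?_ (Polynomial.X_sub_C_ne_zero _))
    rw [Finset.prod_ne_zero_iff]
    intro x hx hz
    have h1 := hs0 x hx
    rw [eval_aeval_linePoly, ← hqp x hx, ← eval_aeval_linePoly, hz] at h1
    simp at h1
  rw [Polynomial.eval_mul, Polynomial.eval_prod, mul_ne_zero_iff, Finset.prod_ne_zero_iff] at hy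
  obtain ⟨hy1, hy2⟩ := hy
  have hex : ∀ x ∈ s, ∃ r : F × F × F, r.1 = y ∧ OnSurf 1 r f ∧
      linePt 1 r x = linePt 2 (q x) y := by
    intro x hx
    have h1 := hy1 x hx
    rw [eval_aeval_linePoly] at h1
    obtain ⟨r, e1, e2, e3⟩ := exists_onSurf_of_dvd_flex (i := 1) (j := 2) (by decide) (by decide)
      (by decide) hf h0 hflex₁ hchar ((hqf x hx).eval_eq_zero y) h1
    exact ⟨r, e1.trans (by simp [linePt]), e2, by simpa [linePt, hq1 x hx] using e3⟩
  choose! r hr1 hrf hrp using hex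
  have hM : (s.image r).card ≤ f.totalDegree := by
    obtain ⟨w, hw⟩ : ∃ w, ((∏ m ∈ s.image r, aeval (linePoly 1 m) (pderiv 0 f)) *
        ∏ m ∈ (s.image r).offDiag, (Polynomial.C (m.1.2.1 - m.2.2.1) * Polynomial.X +
          Polynomial.C (m.1.2.2 - m.2.2.2))).eval w ≠ 0 := by
      refine exists_eval_ne_zero (mul_ne_zero ?_ ?_)
      · rw [Finset.prod_ne_zero_iff]
        intro m hm hz
        obtain ⟨x, hx, rfl⟩ := Finset.mem_image.1 hm
        have h1 := hy1 x hx
        rw [eval_aeval_linePoly, ← hrp x hx, ← eval_aeval_linePoly, hz] at h1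
        simp at h1
      · rw [Finset.prod_ne_zero_iff]
        rintro ⟨m, m'⟩ hm hz
        simp only [Finset.mem_offDiag, Finset.mem_image] at hm
        obtain ⟨⟨x, hx, rfl⟩, ⟨x', hx', rfl⟩, hne⟩ := hm
        apply hne
        have c0 := congrArg (fun P => Polynomial.coeff P 0) hz
        have c1 := congrArg (fun P => Polynomial.coeff P 1) hz
        simp [sub_eq_zero, Polynomial.coeff_C] at c0 c1
        exact Prod.ext ((hr1 x hx).trans (hr1 x' hx').symm) (Prod.ext c1 c0)
    rw [Polynomial.eval_mul, Polynomial.eval_prod, Polynomial.eval_prod, mul_ne_zero_iff,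
      Finset.prod_ne_zero_iff, Finset.prod_ne_zero_iff] at hw
    obtain ⟨hw1, hw2⟩ := hw
    let γ : Fin 3 → Polynomial F := fun a => if a = 0 then Polynomial.X
      else if a = 1 then Polynomial.C w else Polynomial.C y
    have hev : ∀ m ∈ s.image r, ∀ g : MvPolynomial (Fin 3) F,
        (aeval γ g).eval (m.2.1 * w + m.2.2) = eval (linePt 1 m w) g := by
      intro m hm g
      obtain ⟨x, hx, rfl⟩ := Finset.mem_image.1 hm
      rw [eval_aeval_polynomial]
      congr 2
      funext a
      simp only [γ, linePt, hr1 x hx]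
      split_ifs <;> simp
    have hder : Polynomial.derivative (aeval γ f) = aeval γ (pderiv 0 f) := by
      have := derivation_aeval (F := F) Polynomial.derivative' γ f
      rw [show Polynomial.derivative (aeval γ f) = Polynomial.derivative' (aeval γ f) from rfl,
        this, Fin.sum_univ_three]
      simp [γ, Polynomial.derivative']
    have hne : aeval γ f ≠ 0 := by
      intro hz
      obtain ⟨x, hx⟩ : s.Nonempty := Finset.card_pos.1 (by omega)
      have hx' := Finset.mem_image_of_mem r hx
      have h1 := hw1 _ hx'
      rw [eval_aeval_linePoly, ← hev _ hx', ← hder, hz] at h1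
      simp at h1
    have hdeg : (aeval γ f).natDegree ≤ f.totalDegree * 1 := by
      refine aeval_natDegree_le f le_rfl γ fun a => ?_
      simp only [γ]
      split_ifs <;> simp
    have hinj : Set.InjOn (fun m : F × F × F => m.2.1 * w + m.2.2) (s.image r : Finset _) := by
      intro m hm m' hm' h
      by_contra hne
      apply hw2 (m, m') (Finset.mem_offDiag.2 ⟨hm, hm', hne⟩)
      simp only [Polynomial.eval_add, Polynomial.eval_mul, Polynomial.eval_C, Polynomial.eval_X]
      simp only at h
      linear_combination h
    rw [← Finset.card_image_of_injOn hinj]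
    refine (card_le_of_eval_eq_zero hne ?_).trans (by omega)
    intro z hz
    obtain ⟨m, hm, rfl⟩ := Finset.mem_image.1 hz
    rw [hev m hm]
    obtain ⟨x, hx, rfl⟩ := Finset.mem_image.1 hm
    exact (hrf x hx).eval_eq_zero _
  obtain ⟨m₂, hm₂, hcard⟩ := Finset.exists_lt_card_fiber_of_mul_lt_card_of_maps_to
    (s := s) (t := s.image r) (f := r) (n := f.totalDegree)
    (fun x hx => Finset.mem_image_of_mem r hx) (by nlinarith)
  have hinj : Set.InjOn q (s.filter fun x => r x = m₂) := by
    intro x hx x' hx' h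
    simp only [Finset.coe_filter, Set.mem_ofPred_eq] at hx hx'
    rw [← hq1 x hx.1, ← hq1 x' hx'.1, h]
  refine inc_of_card_lt (m₁ := m₁) (m₂ := m₂) (L := (s.filter fun x => r x = m₂).image q) hf
    ?_ ?_ ?_ ?_ ?_ (by rwa [Finset.card_image_of_injOn hinj]) hl hm
  · obtain ⟨x, hx, rfl⟩ := Finset.mem_image.1 hm₂
    rw [hr1 x hx]
    intro h
    apply hy2
    simp [h]
  · intro l hl l' hl' h
    simp only [Finset.coe_image, Set.mem_image, Finset.coe_filter, Set.mem_ofPred_eq] at hl hl'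
    obtain ⟨x, hx, rfl⟩ := hl
    obtain ⟨x', hx', rfl⟩ := hl'
    rw [hq1 x hx.1, hq1 x' hx'.1] at h
    rw [h]
  · intro l hl
    obtain ⟨x, hx, rfl⟩ := Finset.mem_image.1 hl
    exact hqf x (Finset.mem_filter.1 hx).1
  · intro l hl
    obtain ⟨x, hx, rfl⟩ := Finset.mem_image.1 hl
    have hx := (Finset.mem_filter.1 hx).1
    exact inc_of_linePt_eq (i := 2) (j := 1) (by rw [hqp x hx, hq1 x hx])
  · intro l hl
    obtain ⟨x, hx, rfl⟩ := Finset.mem_image.1 hl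
    obtain ⟨hxs, rfl⟩ := Finset.mem_filter.1 hx
    exact inc_of_linePt_eq (i := 2) (j := 1) (by rw [hr1 x hxs, hq1 x hxs, hrp x hxs])

lemma finSuccEquiv_pderiv_zero (f : MvPolynomial (Fin 3) F) :
    finSuccEquiv F 2 (pderiv 0 f) = Polynomial.derivative (finSuccEquiv F 2 f) := by
  induction f using MvPolynomial.induction_on with
  | C r =>
    have : finSuccEquiv F 2 (C r) = Polynomial.C (C r) := (finSuccEquiv F 2).commutes r
    simp [this]
  | add p q hp hq => simp only [map_add, hp, hq]
  | mul_X p b hp =>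
    have h0 : finSuccEquiv F 2 (X 0) = Polynomial.X := finSuccEquiv_X_zero
    have h1 (c : Fin 2) : finSuccEquiv F 2 (X c.succ) = Polynomial.C (X c) := finSuccEquiv_X_succ
    simp only [Derivation.leibniz, smul_eq_mul, map_add, map_mul, hp, Polynomial.derivative_mul]
    refine Fin.cases ?_ (fun c => ?_) b
    · simp [h0, mul_comm, add_comm]
    · simp [h1, mul_comm]

/-- A polynomial involving the coordinate `0` does not divide its derivative. -/
lemma not_dvd_pderiv_zero {f : MvPolynomial (Fin 3) F} (hd : f.degreeOf 0 ≠ 0)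
    (hchar : ∀ j : ℕ, 0 < j → j ≤ f.totalDegree → (j : F) ≠ 0) : ¬ f ∣ pderiv 0 f := by
  intro h
  have hpos := hd
  rw [← natDegree_finSuccEquiv] at hpos
  have h2 : finSuccEquiv F 2 f ∣ Polynomial.derivative (finSuccEquiv F 2 f) := by
    rw [← finSuccEquiv_pderiv_zero]; exact map_dvd _ h
  have h3 : Polynomial.derivative (finSuccEquiv F 2 f) ≠ 0 := by
    intro hz
    have := congrArg (fun P => Polynomial.coeff P ((finSuccEquiv F 2 f).natDegree - 1)) hz
    simp only [Polynomial.coeff_derivative, Polynomial.coeff_zero] at this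
    rw [← Nat.cast_add_one, Nat.sub_add_cancel (by omega)] at this
    have hn : (((finSuccEquiv F 2 f).natDegree : ℕ) : MvPolynomial (Fin 2) F) =
      C (((finSuccEquiv F 2 f).natDegree : ℕ) : F) := by simp
    refine (mul_eq_zero.1 this).elim (fun h => hpos ?_) (fun h => ?_)
    · rw [Polynomial.coeff_natDegree, Polynomial.leadingCoeff_eq_zero] at h
      simp [h]
    · rw [hn, C_eq_zero] at h
      exact hchar _ (by omega) (natDegree_finSuccEquiv_le f) h
  have h4 := Polynomial.natDegree_le_of_dvd h2 h3
  have h5 := Polynomial.natDegree_derivative_lt hpos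
  omega

/-- The number of incidences between two finite families of lines. -/
noncomputable def inc (L M : Finset (F × F × F)) : ℕ :=
  ((L ×ˢ M).filter fun p => Inc p.1 p.2).card

lemma inc_eq_sum_right (L M : Finset (F × F × F)) :
    inc L M = ∑ m ∈ M, (L.filter fun l => Inc l m).card := by
  simp only [inc, Finset.card_filter, Finset.sum_product_right]

lemma inc_eq_sum_left (L M : Finset (F × F × F)) :
    inc L M = ∑ l ∈ L, (M.filter fun m => Inc l m).card := by
  simp only [inc, Finset.card_filter, Finset.sum_product]

lemma inc_le_mul_card_right {L M : Finset (F × F × F)} {B : ℕ}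
    (h : ∀ m ∈ M, (L.filter fun l => Inc l m).card ≤ B) : inc L M ≤ B * M.card := by
  rw [inc_eq_sum_right, mul_comm]
  exact Finset.sum_le_card_nsmul _ _ _ h

lemma inc_le_mul_card_left {L M : Finset (F × F × F)} {B : ℕ}
    (h : ∀ l ∈ L, (M.filter fun m => Inc l m).card ≤ B) : inc L M ≤ B * L.card := by
  rw [inc_eq_sum_left, mul_comm]
  exact Finset.sum_le_card_nsmul _ _ _ h

lemma inc_le_card_mul_card (L M : Finset (F × F × F)) : inc L M ≤ L.card * M.card :=
  inc_le_mul_card_right fun _ _ => Finset.card_filter_le _ _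

lemma inc_filter_left (L M : Finset (F × F × F)) (P : F × F × F → Prop) :
    inc L M = inc (L.filter P) M + inc (L.filter fun l => ¬ P l) M := by
  simp only [inc_eq_sum_left]
  exact (Finset.sum_filter_add_sum_filter_not _ _ _).symm

lemma inc_filter_right (L M : Finset (F × F × F)) (P : F × F × F → Prop) :
    inc L M = inc L (M.filter P) + inc L (M.filter fun m => ¬ P m) := by
  simp only [inc_eq_sum_right]
  exact (Finset.sum_filter_add_sum_filter_not _ _ _).symm

lemma inc_add_inc_le {L₁ L₂ M₁ M₂ : Finset (F × F × F)} (h : Disjoint L₁ L₂) :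
    inc L₁ M₁ + inc L₂ M₂ ≤ inc (L₁ ∪ L₂) (M₁ ∪ M₂) := by
  unfold inc
  rw [← Finset.card_union_of_disjoint]
  · refine Finset.card_le_card ?_
    intro p hp
    simp only [Finset.mem_union, Finset.mem_filter, Finset.mem_product] at hp ⊢
    tauto
  · refine Finset.disjoint_filter_filter ?_
    exact Finset.disjoint_product.2 (Or.inl h)

lemma card_filter_inc_le_left {f : MvPolynomial (Fin 3) F} {m : F × F × F} (hm : ¬ OnSurf 1 m f)
    {L : Finset (F × F × F)} (hinj : Set.InjOn Prod.fst (L : Set (F × F × F)))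
    (hL : ∀ l ∈ L, OnSurf 2 l f) : (L.filter fun l => Inc l m).card ≤ f.totalDegree :=
  card_inc_le (by decide) (by decide) (by decide) hm hinj hL

lemma card_filter_inc_le_right {f : MvPolynomial (Fin 3) F} {l : F × F × F} (hl : ¬ OnSurf 2 l f)
    {M : Finset (F × F × F)} (hinj : Set.InjOn Prod.fst (M : Set (F × F × F)))
    (hM : ∀ m ∈ M, OnSurf 1 m f) : (M.filter fun m => Inc l m).card ≤ f.totalDegree := by
  rw [Finset.filter_congr (q := fun m => Inc m l) fun m _ => ⟨Inc.symm, Inc.symm⟩]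
  exact card_inc_le (by decide) (by decide) (by decide) hl hinj hM

lemma card_le_of_degreeOf_eq_zero [Infinite F] {f : MvPolynomial (Fin 3) F} (hf : f ≠ 0)
    (hd : f.degreeOf 0 = 0) {M : Finset (F × F × F)}
    (hinj : Set.InjOn Prod.fst (M : Set (F × F × F))) (hM : ∀ m ∈ M, OnSurf 1 m f) :
    M.card ≤ f.totalDegree := by
  obtain ⟨w, hw⟩ : ∃ w, eval w f ≠ 0 := by
    by_contra! h
    exact hf (funext fun w => by simp [h w])
  have hindep : ∀ x y : Fin 3 → F, x 1 = y 1 → x 2 = y 2 → eval x f = eval y f := by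
    intro x y h1 h2
    rw [← natDegree_finSuccEquiv] at hd
    rw [eval_eq_eval_finSuccEquiv, eval_eq_eval_finSuccEquiv f y,
      Polynomial.eq_C_of_natDegree_eq_zero hd, Polynomial.eval_C, Polynomial.eval_C]
    congr 2
    funext a
    fin_cases a
    · exact h1
    · exact h2
  let γ : Fin 3 → Polynomial F := fun a => if a = 2 then Polynomial.X else Polynomial.C (w 1)
  have hne : aeval γ f ≠ 0 := by
    intro hz
    have h1 := eval_aeval_polynomial γ f (w 2)
    rw [hz, Polynomial.eval_zero, hindep _ w (by simp [γ]) (by simp [γ])] at h1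
    exact hw h1.symm
  have hdeg : (aeval γ f).natDegree ≤ f.totalDegree * 1 := by
    refine aeval_natDegree_le f le_rfl γ fun a => ?_
    simp only [γ]
    split_ifs <;> simp
  rw [← Finset.card_image_of_injOn hinj]
  refine (card_le_of_eval_eq_zero hne ?_).trans (by omega)
  intro y hy
  obtain ⟨m, hm, rfl⟩ := Finset.mem_image.1 hy
  rw [eval_aeval_polynomial, ← (hM m hm).eval_eq_zero (w 1)]
  exact hindep _ _ (by simp [γ, linePt]) (by simp [γ, linePt])

/-- Incidences between lines on two surfaces without common component. -/
lemma exists_subset_of_not_dvd_right [Infinite F] {f G : MvPolynomial (Fin 3) F} (hf : Prime f)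
    (hd : f.degreeOf 0 ≠ 0) (hfG : ¬ f ∣ G) (hG : G.totalDegree ≤ 3 * f.totalDegree)
    {L M : Finset (F × F × F)} (hL : Set.InjOn Prod.fst (L : Set (F × F × F)))
    (hM : Set.InjOn Prod.fst (M : Set (F × F × F))) (hLf : ∀ l ∈ L, OnSurf 2 l f)
    (hMf : ∀ m ∈ M, OnSurf 1 m f) (hMG : ∀ m ∈ M, OnSurf 1 m G) :
    ∃ L' ⊆ L, ∃ M' ⊆ M, L'.card ≤ 6 * f.totalDegree ^ 2 ∧ M'.card ≤ 6 * f.totalDegree ^ 2 ∧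
      inc L M ≤ 3 * f.totalDegree * L.card + inc L' M' := by
  have hb : 2 * f.totalDegree * G.totalDegree ≤ 6 * f.totalDegree ^ 2 := by nlinarith
  refine ⟨L.filter fun l => OnSurf 2 l G, Finset.filter_subset _ _, M, subset_rfl,
    (card_le_of_onSurf_of_onSurf hf hd hfG (i := 2) (by decide)
      (hL.mono (Finset.coe_subset.2 (Finset.filter_subset _ _)))
      (fun l hl => hLf l (Finset.mem_filter.1 hl).1)
      fun l hl => (Finset.mem_filter.1 hl).2).trans hb,
    (card_le_of_onSurf_of_onSurf hf hd hfG (i := 1) (by decide) hM hMf hMG).trans hb, ?_⟩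
  rw [inc_filter_left L M fun l => OnSurf 2 l G, add_comm]
  gcongr
  refine (inc_le_mul_card_left (B := 3 * f.totalDegree) fun l hl => ?_).trans
    (Nat.mul_le_mul_left _ (Finset.card_filter_le _ _))
  exact (card_filter_inc_le_right (Finset.mem_filter.1 hl).2 hM hMG).trans hG

lemma exists_subset_of_not_dvd_left [Infinite F] {f G : MvPolynomial (Fin 3) F} (hf : Prime f)
    (hd : f.degreeOf 0 ≠ 0) (hfG : ¬ f ∣ G) (hG : G.totalDegree ≤ 3 * f.totalDegree)
    {L M : Finset (F × F × F)} (hL : Set.InjOn Prod.fst (L : Set (F × F × F)))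
    (hM : Set.InjOn Prod.fst (M : Set (F × F × F))) (hLf : ∀ l ∈ L, OnSurf 2 l f)
    (hMf : ∀ m ∈ M, OnSurf 1 m f) (hLG : ∀ l ∈ L, OnSurf 2 l G) :
    ∃ L' ⊆ L, ∃ M' ⊆ M, L'.card ≤ 6 * f.totalDegree ^ 2 ∧ M'.card ≤ 6 * f.totalDegree ^ 2 ∧
      inc L M ≤ 3 * f.totalDegree * M.card + inc L' M' := by
  have hb : 2 * f.totalDegree * G.totalDegree ≤ 6 * f.totalDegree ^ 2 := by nlinarith
  refine ⟨L, subset_rfl, M.filter fun m => OnSurf 1 m G, Finset.filter_subset _ _,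
    (card_le_of_onSurf_of_onSurf hf hd hfG (i := 2) (by decide) hL hLf hLG).trans hb,
    (card_le_of_onSurf_of_onSurf hf hd hfG (i := 1) (by decide)
      (hM.mono (Finset.coe_subset.2 (Finset.filter_subset _ _)))
      (fun m hm => hMf m (Finset.mem_filter.1 hm).1)
      fun m hm => (Finset.mem_filter.1 hm).2).trans hb, ?_⟩
  rw [inc_filter_right L M fun m => OnSurf 1 m G, add_comm]
  gcongr
  refine (inc_le_mul_card_right (B := 3 * f.totalDegree) fun m hm => ?_).trans
    (Nat.mul_le_mul_left _ (Finset.card_filter_le _ _))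
  exact (card_filter_inc_le_left (Finset.mem_filter.1 hm).2 hL hLG).trans hG

/-- Incidences on a prime surface reduce to few lines, up to an acceptable error. -/
lemma exists_subset_of_prime [Infinite F] {f : MvPolynomial (Fin 3) F} (hf : Prime f)
    (hchar : ∀ j : ℕ, 0 < j → j ≤ f.totalDegree → (j : F) ≠ 0) {k : ℕ}
    {L M : Finset (F × F × F)} (hL : Set.InjOn Prod.fst (L : Set (F × F × F)))
    (hM : Set.InjOn Prod.fst (M : Set (F × F × F))) (hMf : ∀ m ∈ M, OnSurf 1 m f)
    (hk : ∀ m₁ ∈ M, ∀ m₂ ∈ M, m₁ ≠ m₂ → (L.filter fun l => Inc l m₁ ∧ Inc l m₂).card ≤ k) :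
    ∃ L' ⊆ L, ∃ M' ⊆ M, L'.card ≤ 6 * f.totalDegree ^ 2 ∧ M'.card ≤ 6 * f.totalDegree ^ 2 ∧
      inc L M ≤ 5 * f.totalDegree * (L.card + M.card) + k * M.card + L.card + inc L' M' := by
  set d := f.totalDegree
  by_cases hd : f.degreeOf 0 = 0
  · refine ⟨∅, by simp, ∅, by simp, by simp, by simp, ?_⟩
    have h1 := inc_le_card_mul_card L M
    have h2 : M.card ≤ d := card_le_of_degreeOf_eq_zero hf.ne_zero hd hM hMf
    have h3 : L.card * M.card ≤ L.card * d := Nat.mul_le_mul_left _ h2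
    nlinarith [Nat.zero_le (d * M.card), Nat.zero_le (k * M.card), Nat.zero_le (d * L.card)]
  set L₀ := L.filter fun l => OnSurf 2 l f with hL₀
  have hL₀L : L₀ ⊆ L := Finset.filter_subset _ _
  have hL₀c : L₀.card ≤ L.card := Finset.card_le_card hL₀L
  have hL₀i : Set.InjOn Prod.fst (L₀ : Set (F × F × F)) := hL.mono (Finset.coe_subset.2 hL₀L)
  have hL₀f : ∀ l ∈ L₀, OnSurf 2 l f := fun l hl => (Finset.mem_filter.1 hl).2
  have hsplit : inc L M ≤ d * L.card + inc L₀ M := by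
    rw [inc_filter_left L M fun l => OnSurf 2 l f, add_comm]
    refine Nat.add_le_add_right ?_ _
    exact (inc_le_mul_card_left fun l hl =>
      card_filter_inc_le_right (Finset.mem_filter.1 hl).2 hM hMf).trans
      (Nat.mul_le_mul_left _ (Finset.card_filter_le _ _))
  suffices h : ∃ L' ⊆ L₀, ∃ M' ⊆ M, L'.card ≤ 6 * d ^ 2 ∧ M'.card ≤ 6 * d ^ 2 ∧
      inc L₀ M ≤ 3 * d * (L₀.card + M.card) + k * M.card + L₀.card + inc L' M' by
    obtain ⟨L', hL', M', hM', h1, h2, h3⟩ := h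
    refine ⟨L', hL'.trans hL₀L, M', hM', h1, h2, ?_⟩
    have h4 : d * L₀.card ≤ d * L.card := Nat.mul_le_mul_left _ hL₀c
    nlinarith [Nat.zero_le (d * M.card), Nat.zero_le (d * L.card)]
  have caseA : ∀ G : MvPolynomial (Fin 3) F, ¬ f ∣ G → G.totalDegree ≤ 3 * d →
      (∀ m ∈ M, OnSurf 1 m G) → ∃ L' ⊆ L₀, ∃ M' ⊆ M, L'.card ≤ 6 * d ^ 2 ∧ M'.card ≤ 6 * d ^ 2 ∧
      inc L₀ M ≤ 3 * d * (L₀.card + M.card) + k * M.card + L₀.card + inc L' M' := by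
    intro G h1 h2 h3
    obtain ⟨L', hL', M', hM', e1, e2, e3⟩ :=
      exists_subset_of_not_dvd_right hf hd h1 h2 hL₀i hM hL₀f hMf h3
    exact ⟨L', hL', M', hM', e1, e2, by nlinarith [Nat.zero_le (d * M.card)]⟩
  have h0 := not_dvd_pderiv_zero hd hchar
  by_cases hx1 : f ∣ flex 1 f
  swap
  · exact caseA _ hx1 (totalDegree_flex_le _ _) fun m hm => (hMf m hm).flex (by decide)
  by_cases hx2 : f ∣ flex 2 f
  swap
  · obtain ⟨L', hL', M', hM', e1, e2, e3⟩ :=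
      exists_subset_of_not_dvd_left hf hd hx2 (totalDegree_flex_le _ _) hL₀i hM hL₀f hMf
        fun l hl => (hL₀f l hl).flex (by decide)
    exact ⟨L', hL', M', hM', e1, e2, by nlinarith [Nat.zero_le (d * L₀.card)]⟩
  by_cases hall : ∀ m ∈ M, OnSurf 1 m (pderiv 0 f)
  · exact caseA _ h0 ((totalDegree_pderiv_le _ _).trans (by omega)) hall
  push Not at hall
  obtain ⟨m, hm, hm0⟩ := hall
  have hinc : ∀ l ∈ L₀, ∀ m' ∈ M, Inc l m' := fun l hl m' hm' =>
    inc_of_dvd_flex hf h0 hx1 hx2 hchar (hMf m hm) hm0 (hL₀f l hl) (hMf m' hm')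
  refine ⟨∅, by simp, ∅, by simp, by simp, by simp, ?_⟩
  have h1 := inc_le_card_mul_card L₀ M
  by_cases hM1 : M.card ≤ 1
  · have h3 : L₀.card * M.card ≤ L₀.card * 1 := Nat.mul_le_mul_left _ hM1
    nlinarith [Nat.zero_le (d * M.card), Nat.zero_le (k * M.card), Nat.zero_le (d * L₀.card)]
  · obtain ⟨m₁, hm₁, m₂, hm₂, hne⟩ := Finset.one_lt_card.1 (not_le.1 hM1)
    have h2 : L₀.card ≤ k := by
      refine (Finset.card_le_card ?_).trans (hk m₁ hm₁ m₂ hm₂ hne)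
      intro l hl
      exact Finset.mem_filter.2 ⟨hL₀L hl, hinc l hl m₁ hm₁, hinc l hl m₂ hm₂⟩
    have h3 : L₀.card * M.card ≤ k * M.card := Nat.mul_le_mul_right _ h2
    nlinarith [Nat.zero_le (d * M.card), Nat.zero_le (d * L₀.card)]

/-- Incidences on a surface reduce to few lines, up to an acceptable error. -/
lemma exists_subset_of_onSurf [Infinite F] (k : ℕ) (f : MvPolynomial (Fin 3) F) :
    f ≠ 0 → (∀ j : ℕ, 0 < j → j ≤ f.totalDegree → (j : F) ≠ 0) →
    ∀ L M : Finset (F × F × F), Set.InjOn Prod.fst (L : Set (F × F × F)) →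
    Set.InjOn Prod.fst (M : Set (F × F × F)) → (∀ m ∈ M, OnSurf 1 m f) →
    (∀ m₁ ∈ M, ∀ m₂ ∈ M, m₁ ≠ m₂ → (L.filter fun l => Inc l m₁ ∧ Inc l m₂).card ≤ k) →
    ∃ L' ⊆ L, ∃ M' ⊆ M, L'.card ≤ 6 * f.totalDegree ^ 2 ∧ M'.card ≤ 6 * f.totalDegree ^ 2 ∧
      inc L M ≤ 5 * f.totalDegree * (L.card + M.card) + k * M.card + L.card + inc L' M' := by
  induction f using UniqueFactorizationMonoid.induction_on_prime with
  | h₁ => exact fun h => absurd rfl h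
  | h₂ u hu =>
    intro _ _ L M _ _ hMf _
    have : M = ∅ := by
      refine Finset.eq_empty_of_forall_notMem fun m hm => ?_
      exact (hu.map (aeval (R := F) (linePoly 1 m))).ne_zero (hMf m hm)
    subst this
    exact ⟨∅, by simp, ∅, by simp, by simp, by simp, by simp [inc]⟩
  | h₃ h g hh hg ih =>
    intro _ hchar L M hL hM hMf hk
    have hdeg : (g * h).totalDegree = g.totalDegree + h.totalDegree :=
      totalDegree_mul_of_isDomain hg.ne_zero hh
    rw [hdeg] at hchar ⊢
    set Lg := L.filter fun l => OnSurf 2 l g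
    set Lr := L.filter fun l => ¬ OnSurf 2 l g
    set Mg := M.filter fun m => OnSurf 1 m g
    set Mr := M.filter fun m => ¬ OnSurf 1 m g
    have hLg : Lg ⊆ L := Finset.filter_subset _ _
    have hLr : Lr ⊆ L := Finset.filter_subset _ _
    have hMg : Mg ⊆ M := Finset.filter_subset _ _
    have hMr : Mr ⊆ M := Finset.filter_subset _ _
    have hLgi := hL.mono (Finset.coe_subset.2 hLg)
    have hLri := hL.mono (Finset.coe_subset.2 hLr)
    have hMgi := hM.mono (Finset.coe_subset.2 hMg)
    have hMri := hM.mono (Finset.coe_subset.2 hMr)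
    have hLc : Lg.card + Lr.card = L.card := Finset.card_filter_add_card_filter_not _
    have hMc : Mg.card + Mr.card = M.card := Finset.card_filter_add_card_filter_not _
    have hkk : ∀ {L₁ M₁}, L₁ ⊆ L → M₁ ⊆ M → ∀ m₁ ∈ M₁, ∀ m₂ ∈ M₁, m₁ ≠ m₂ →
        (L₁.filter fun l => Inc l m₁ ∧ Inc l m₂).card ≤ k := fun h1 h2 m₁ hm₁ m₂ hm₂ hne =>
      (Finset.card_le_card (Finset.filter_subset_filter _ h1)).trans
        (hk m₁ (h2 hm₁) m₂ (h2 hm₂) hne)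
    obtain ⟨L₁, hL₁, M₁, hM₁, a1, a2, a3⟩ := exists_subset_of_prime hg
      (fun j h1 h2 => hchar j h1 (by omega)) hLgi hMgi (fun m hm => (Finset.mem_filter.1 hm).2)
      (hkk hLg hMg)
    obtain ⟨L₂, hL₂, M₂, hM₂, b1, b2, b3⟩ := ih hh
      (fun j h1 h2 => hchar j h1 (by omega)) Lr Mr hLri hMri (fun m hm => by
        obtain ⟨h1, h2⟩ := Finset.mem_filter.1 hm
        exact (onSurf_mul.1 (hMf m h1)).resolve_left h2) (hkk hLr hMr)
    have c1 : inc Lg Mr ≤ g.totalDegree * Mr.card := inc_le_mul_card_right fun m hm =>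
      card_filter_inc_le_left (Finset.mem_filter.1 hm).2 hLgi fun l hl => (Finset.mem_filter.1 hl).2
    have c2 : inc Lr Mg ≤ g.totalDegree * Lr.card := inc_le_mul_card_left fun l hl =>
      card_filter_inc_le_right (Finset.mem_filter.1 hl).2 hMgi
        fun m hm => (Finset.mem_filter.1 hm).2
    have hsplit : inc L M = (inc Lg Mg + inc Lg Mr) + (inc Lr Mg + inc Lr Mr) := by
      rw [inc_filter_left L M fun l => OnSurf 2 l g, inc_filter_right Lg M fun m => OnSurf 1 m g,
        inc_filter_right Lr M fun m => OnSurf 1 m g]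
    have hdis : Disjoint L₁ L₂ :=
      (Finset.disjoint_filter_filter_not L L fun l => OnSurf 2 l g).mono hL₁ hL₂
    have hadd := inc_add_inc_le (M₁ := M₁) (M₂ := M₂) hdis
    have hsq : 6 * g.totalDegree ^ 2 + 6 * h.totalDegree ^ 2 ≤
      6 * (g.totalDegree + h.totalDegree) ^ 2 := by nlinarith
    refine ⟨L₁ ∪ L₂, Finset.union_subset (hL₁.trans hLg) (hL₂.trans hLr), M₁ ∪ M₂,
      Finset.union_subset (hM₁.trans hMg) (hM₂.trans hMr),
      (Finset.card_union_le _ _).trans (by omega), (Finset.card_union_le _ _).trans (by omega), ?_⟩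
    rw [hsplit, ← hLc, ← hMc]
    set dg := g.totalDegree
    set dh := h.totalDegree
    nlinarith [Nat.zero_le (dg * Lr.card), Nat.zero_le (dg * Mr.card), Nat.zero_le (dh * Lg.card),
      Nat.zero_le (dh * Mg.card)]

/-- A random sample of density `θ` approximates all the given statistics simultaneously. -/
lemma exists_sample {ι κ : Type*} (L : Finset ι) (J : Finset κ) (ω : κ → ℝ) (w : ι → κ → ℝ)
    {θ : ℝ} (hω : ∀ j ∈ J, 0 ≤ ω j) (hθ₀ : 0 ≤ θ) (hθ₁ : θ ≤ 1) :
    ∃ L₀ ⊆ L, ∑ j ∈ J, ω j * (∑ l ∈ L₀, w l j - θ * ∑ l ∈ L, w l j) ^ 2 ≤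
      θ * ∑ l ∈ L, ∑ j ∈ J, ω j * w l j ^ 2 := by
  induction L using Finset.induction_on with
  | empty => exact ⟨∅, by simp, by simp⟩
  | insert a L ha ih =>
    obtain ⟨L₀, hL₀, h⟩ := ih
    have ha₀ : a ∉ L₀ := fun h => ha (hL₀ h)
    by_contra! hcon
    have h1 := hcon L₀ (hL₀.trans (Finset.subset_insert _ _))
    have h2 := hcon (insert a L₀) (Finset.insert_subset_insert _ hL₀)
    simp only [Finset.sum_insert ha, Finset.sum_insert ha₀] at h1 h2
    set e : κ → ℝ := fun j => ∑ l ∈ L₀, w l j - θ * ∑ l ∈ L, w l j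
    have key : (1 - θ) * ∑ j ∈ J, ω j * (∑ l ∈ L₀, w l j - θ * (w a j + ∑ l ∈ L, w l j)) ^ 2 +
        θ * ∑ j ∈ J, ω j * (w a j + ∑ l ∈ L₀, w l j - θ * (w a j + ∑ l ∈ L, w l j)) ^ 2 =
        ∑ j ∈ J, ω j * (e j) ^ 2 + θ * (1 - θ) * ∑ j ∈ J, ω j * w a j ^ 2 := by
      simp only [Finset.mul_sum, ← Finset.sum_add_distrib]
      refine Finset.sum_congr rfl fun j _ => ?_
      simp only [e]
      ring
    have hpos : 0 ≤ ∑ j ∈ J, ω j * w a j ^ 2 :=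
      Finset.sum_nonneg fun j hj => mul_nonneg (hω j hj) (sq_nonneg _)
    have h3 : 0 ≤ θ ^ 2 * ∑ j ∈ J, ω j * w a j ^ 2 := mul_nonneg (sq_nonneg _) hpos
    rcases eq_or_lt_of_le hθ₀ with h0 | h0
    · rw [← h0] at h1 key h
      simp only [one_mul, zero_mul, sub_zero, add_zero] at h1 key h
      have : ∑ j ∈ J, ω j * (e j) ^ 2 ≤ 0 := by
        simpa [e, ← h0] using h
      linarith
    · nlinarith [mul_lt_mul_of_pos_left h2 h0, mul_le_mul_of_nonneg_left h1.le (sub_nonneg.2 hθ₁)]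

lemma exists_sample_inc (L M : Finset (F × F × F)) {N θ : ℝ} (hL : L.card ≤ N) (hθ₀ : 0 ≤ θ)
    (hθ₁ : θ ≤ 1) (hN : 2 ≤ θ * N) (hinc : 0 < inc L M) :
    ∃ L₀ ⊆ L, (L₀.card : ℝ) ≤ 2 * (θ * N) ∧
      ∑ m ∈ M, (((L₀.filter fun l => Inc l m).card : ℝ) -
        θ * (L.filter fun l => Inc l m).card) ^ 2 ≤ 2 * θ * inc L M := by
  have hI : (0 : ℝ) < inc L M := by exact_mod_cast hinc
  have hNpos : 0 < N := by
    by_contra! h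
    nlinarith
  obtain ⟨L₀, hL₀, h⟩ := exists_sample L (Finset.insertNone M)
    (fun j => j.elim (inc L M / N) fun _ => 1)
    (fun l j => j.elim 1 fun m => if Inc l m then 1 else 0) (θ := θ) (by
      rintro (_ | j) _
      · exact div_nonneg hI.le hNpos.le
      · simp) hθ₀ hθ₁
  simp only [Finset.sum_insertNone, Option.elim, one_mul] at h
  simp only [Finset.sum_boole, Finset.sum_const, nsmul_eq_mul, mul_one, one_pow,
    Finset.sum_add_distrib] at h
  have h1 : ∑ l ∈ L, ∑ m ∈ M, (if Inc l m then (1 : ℝ) else 0) ^ 2 = inc L M := by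
    rw [inc_eq_sum_left]
    push_cast
    refine Finset.sum_congr rfl fun l _ => ?_
    simp
  rw [h1] at h
  have h2 : (L.card : ℝ) * (inc L M / N) ≤ inc L M := by
    rw [mul_div_assoc', div_le_iff₀ hNpos]
    nlinarith
  have h3 : θ * ((L.card : ℝ) * (inc L M / N) + inc L M) ≤ 2 * θ * inc L M := by nlinarith
  have hs : 0 ≤ ∑ m ∈ M, (((L₀.filter fun l => Inc l m).card : ℝ) -
        θ * (L.filter fun l => Inc l m).card) ^ 2 := Finset.sum_nonneg fun _ _ => sq_nonneg _
  have hs' : 0 ≤ inc L M / N * ((L₀.card : ℝ) - θ * L.card) ^ 2 := by positivity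
  refine ⟨L₀, hL₀, ?_, by linarith⟩
  have h4 : inc L M / N * ((L₀.card : ℝ) - θ * L.card) ^ 2 ≤ 2 * θ * inc L M := by linarith
  rw [div_mul_eq_mul_div, div_le_iff₀ hNpos] at h4
  have h5 : ((L₀.card : ℝ) - θ * L.card) ^ 2 ≤ 2 * (θ * N) := by
    by_contra! h5
    nlinarith
  by_contra! h6
  have h7 : θ * L.card ≤ θ * N := mul_le_mul_of_nonneg_left hL hθ₀
  nlinarith

/-- A surface of low degree containing a given family of lines. -/
lemma exists_surface (L : Finset (F × F × F)) {D : ℕ} (hD : 0 < D) (hL : 3 * L.card ≤ D ^ 2) :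
    ∃ f : MvPolynomial (Fin 3) F, f ≠ 0 ∧ f.totalDegree ≤ 3 * (D - 1) ∧
      ∀ l ∈ L, OnSurf 2 l f := by
  let e : (Fin 3 → Fin D) → (Fin 3 →₀ ℕ) := fun u =>
    Finsupp.equivFunOnFinite.symm fun a => (u a : ℕ)
  have he : Function.Injective e := by
    intro u v h
    funext a
    exact Fin.ext (DFunLike.congr_fun h a)
  let T : ((Fin 3 → Fin D) → F) →ₗ[F] MvPolynomial (Fin 3) F :=
    Fintype.linearCombination F fun u => monomial (e u) (1 : F)
  have hT : ∀ c u, coeff (e u) (T c) = c u := by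
    intro c u
    simp [T, Fintype.linearCombination_apply, coeff_sum, coeff_monomial, he.eq_iff]
  have hTd : ∀ c, (T c).totalDegree ≤ 3 * (D - 1) := by
    intro c
    simp only [T, Fintype.linearCombination_apply]
    refine totalDegree_finsetSum_le fun u _ => ?_
    refine (totalDegree_smul_le _ _).trans ((totalDegree_monomial_le _ _).trans ?_)
    rw [Finsupp.sum_fintype _ _ (fun _ => rfl), Fin.sum_univ_three]
    simp only [e, id, Finsupp.equivFunOnFinite_symm_apply_apply]
    omega
  let Φ : ((Fin 3 → Fin D) → F) →ₗ[F] ((L × Fin (3 * (D - 1) + 1)) → F) :=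
    LinearMap.pi fun p => Polynomial.lcoeff F p.2 ∘ₗ
      (aeval (R := F) (linePoly 2 p.1.1)).toLinearMap ∘ₗ T
  have hfin : Module.finrank F ((L × Fin (3 * (D - 1) + 1)) → F) <
      Module.finrank F ((Fin 3 → Fin D) → F) := by
    simp only [Module.finrank_fintype_fun_eq_card, Fintype.card_prod, Fintype.card_coe,
      Fintype.card_fin, Fintype.card_pi, Finset.prod_const, Finset.card_univ]
    obtain ⟨E, rfl⟩ : ∃ E, D = E + 1 := ⟨D - 1, by omega⟩
    simp only [Nat.add_sub_cancel]
    nlinarith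
  obtain ⟨c, hc, hc0⟩ := Submodule.exists_mem_ne_zero_of_ne_bot
    (LinearMap.ker_ne_bot_of_finrank_lt (f := Φ) hfin)
  refine ⟨T c, ?_, hTd c, fun l hl => ?_⟩
  · intro h
    apply hc0
    funext u
    rw [← hT c u, h]; simp
  · ext n
    by_cases hn : n < 3 * (D - 1) + 1
    · have := congrFun (LinearMap.mem_ker.1 hc) (⟨l, hl⟩, ⟨n, hn⟩)
      simpa [Φ] using this
    · rw [Polynomial.coeff_eq_zero_of_natDegree_lt]
      · simp
      · have h1 := natDegree_aeval_linePoly 2 l (T c)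
        have := hTd c
        omega

/-- One step of the induction: all but few of the incidences involve lines on a surface of low
degree. -/
lemma exists_surface_inc_le {L M : Finset (F × F × F)} {N r : ℝ} (hLN : L.card ≤ N)
    (hMN : M.card ≤ N) (hL : Set.InjOn Prod.fst (L : Set (F × F × F))) (hr : 1000 ≤ r)
    (hrN : r * r = N) : ∃ f : MvPolynomial (Fin 3) F, f ≠ 0 ∧ (f.totalDegree : ℝ) ≤ 3 / 100 * r ∧
      (inc L M : ℝ) ≤ 7200 * r * N + 2 * inc L (M.filter fun m => OnSurf 1 m f) := by
  have hNpos : 0 < N := by nlinarith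
  rcases Nat.eq_zero_or_pos (inc L M) with h0 | hpos
  · refine ⟨1, one_ne_zero, by simp; linarith, ?_⟩
    rw [h0]
    push_cast
    positivity
  obtain ⟨L₀, hL₀, hcard, hsum⟩ := exists_sample_inc L M (θ := 1 / 60000) hLN (by norm_num)
    (by norm_num) (by nlinarith) hpos
  have hD1 := Nat.le_ceil (r / 100)
  have hD2 := Nat.ceil_lt_add_one (a := r / 100) (by linarith)
  have hD0 : 0 < ⌈r / 100⌉₊ := Nat.ceil_pos.2 (by linarith)
  obtain ⟨f, hf, hfd, hfL⟩ := exists_surface L₀ hD0 (by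
    have : (3 * L₀.card : ℝ) ≤ (⌈r / 100⌉₊ : ℝ) ^ 2 := by nlinarith
    exact_mod_cast this)
  have hd : (f.totalDegree : ℝ) ≤ 3 / 100 * r := by
    have h1 : (f.totalDegree : ℝ) ≤ ((3 * (⌈r / 100⌉₊ - 1) : ℕ) : ℝ) := by exact_mod_cast hfd
    rw [Nat.cast_mul, Nat.cast_sub hD0] at h1
    push_cast at h1
    linarith
  refine ⟨f, hf, hd, ?_⟩
  set i : F × F × F → ℝ := fun m => (L.filter fun l => Inc l m).card
  set i₀ : F × F × F → ℝ := fun m => (L₀.filter fun l => Inc l m).card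
  have hi : ∀ m, 0 ≤ i m := fun m => Nat.cast_nonneg _
  set S := M.filter fun m => ¬ OnSurf 1 m f
  have hpt : ∀ m ∈ S, i m ≤ 3600 * r + 1 / 2 * 30000 * (i₀ m - 1 / 60000 * i m) ^ 2 := by
    intro m hm
    have h1 : i₀ m ≤ 3 / 100 * r := by
      refine le_trans ?_ hd
      exact Nat.cast_le.2 (card_filter_inc_le_left (Finset.mem_filter.1 hm).2
        (hL.mono (Finset.coe_subset.2 hL₀)) hfL)
    by_cases hc : i m ≤ 3600 * r
    · nlinarith [sq_nonneg (i₀ m - 1 / 60000 * i m)]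
    · push Not at hc
      have h2 : 1 / 120000 * i m ≤ 1 / 60000 * i m - i₀ m := by linarith
      have h3 : (1 / 120000 * i m) ^ 2 ≤ (i₀ m - 1 / 60000 * i m) ^ 2 := by
        rw [← neg_sub (1 / 60000 * i m), neg_sq]
        exact pow_le_pow_left₀ (by linarith [hi m]) h2 2
      nlinarith [hi m]
  have hS : (inc L S : ℝ) ≤ 3600 * r * N + 1 / 2 * inc L M := by
    have e1 : (inc L S : ℝ) = ∑ m ∈ S, i m := by
      rw [inc_eq_sum_right]; push_cast; rfl
    have e2 : ∑ m ∈ S, (i₀ m - 1 / 60000 * i m) ^ 2 ≤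
        ∑ m ∈ M, (i₀ m - 1 / 60000 * i m) ^ 2 :=
      Finset.sum_le_sum_of_subset_of_nonneg (Finset.filter_subset _ _) fun _ _ _ => sq_nonneg _
    have e3 := Finset.sum_le_sum hpt
    rw [Finset.sum_add_distrib, Finset.sum_const, nsmul_eq_mul, ← Finset.mul_sum] at e3
    have e4 : (S.card : ℝ) ≤ N :=
      le_trans (by exact_mod_cast Finset.card_le_card (Finset.filter_subset _ _)) hMN
    have e5 : (S.card : ℝ) * (3600 * r) ≤ N * (3600 * r) :=
      mul_le_mul_of_nonneg_right e4 (by linarith)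
    have e6 : (∑ m ∈ M, (i₀ m - 1 / 60000 * i m) ^ 2 : ℝ) ≤ 2 * (1 / 60000) * inc L M := hsum
    linarith
  have hsplit : (inc L M : ℝ) = inc L (M.filter fun m => OnSurf 1 m f) + inc L S := by
    exact_mod_cast inc_filter_right L M fun m => OnSurf 1 m f
  linarith

/-- The incidence bound for two families of lines with distinct directrix coordinates. -/
theorem inc_le [Infinite F] (k : ℕ) (N : ℕ) : ∀ L M : Finset (F × F × F),
    L.card ≤ N → M.card ≤ N → Set.InjOn Prod.fst (L : Set (F × F × F)) →
    Set.InjOn Prod.fst (M : Set (F × F × F)) →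
    (∀ m₁ ∈ M, ∀ m₂ ∈ M, m₁ ≠ m₂ → (L.filter fun l => Inc l m₁ ∧ Inc l m₂).card ≤ k) →
    (∀ j : ℕ, 0 < j → j * j ≤ N → (j : F) ≠ 0) →
    (inc L M : ℝ) ≤ 20000 * (N * √N + k * N) := by
  induction N using Nat.strong_induction_on with
  | _ N ih =>
  intro L M hLN hMN hL hM hk hchar
  set r := √(N : ℝ)
  have hr0 : 0 ≤ r := Real.sqrt_nonneg _
  have hrr : r * r = N := Real.mul_self_sqrt (Nat.cast_nonneg _)
  have hLN' : (L.card : ℝ) ≤ N := by exact_mod_cast hLN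
  have hMN' : (M.card : ℝ) ≤ N := by exact_mod_cast hMN
  have hkN : (0 : ℝ) ≤ k * N := by positivity
  rcases lt_or_ge r 1000 with hr | hr
  · have h1 : (inc L M : ℝ) ≤ L.card * M.card := by exact_mod_cast inc_le_card_mul_card L M
    have h2 : (L.card : ℝ) * M.card ≤ N * N := by gcongr
    have h3 : (N : ℝ) * N ≤ 1000 * (N * r) := by
      have : (N : ℝ) * r * r ≤ N * r * 1000 := by gcongr
      nlinarith
    have : 0 ≤ (N : ℝ) * r := by positivity
    linarith
  obtain ⟨f, hf, hfd, hI⟩ := exists_surface_inc_le hLN' hMN' hL hr hrr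
  set d := f.totalDegree
  have hd2 : (6 * d ^ 2 : ℝ) ≤ 1 / 100 * N := by
    have : (d : ℝ) ^ 2 ≤ (3 / 100 * r) ^ 2 := by gcongr
    nlinarith
  set M₁ := M.filter fun m => OnSurf 1 m f
  have hM₁ : M₁ ⊆ M := Finset.filter_subset _ _
  have hkk : ∀ {L' M'}, L' ⊆ L → M' ⊆ M → ∀ m₁ ∈ M', ∀ m₂ ∈ M', m₁ ≠ m₂ →
        (L'.filter fun l => Inc l m₁ ∧ Inc l m₂).card ≤ k := fun h1 h2 m₁ hm₁ m₂ hm₂ hne =>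
      (Finset.card_le_card (Finset.filter_subset_filter _ h1)).trans
        (hk m₁ (h2 hm₁) m₂ (h2 hm₂) hne)
  have hNpos : (0 : ℝ) < N := by nlinarith
  have hlt : 6 * d ^ 2 < N := by
    have : (6 * d ^ 2 : ℝ) < N := by linarith
    exact_mod_cast this
  obtain ⟨L', hL', M', hM', h1, h2, h3⟩ := exists_subset_of_onSurf k f hf (fun j hj hjd =>
    hchar j hj (by nlinarith)) L M₁ hL (hM.mono (Finset.coe_subset.2 hM₁))
    (fun m hm => (Finset.mem_filter.1 hm).2) (hkk subset_rfl hM₁)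
  have hM'M := hM'.trans hM₁
  have h4 := ih (6 * d ^ 2) hlt L' M' h1 h2 (hL.mono (Finset.coe_subset.2 hL'))
    (hM.mono (Finset.coe_subset.2 hM'M)) (hkk hL' hM'M) fun j h1 h2 => hchar j h1 (by omega)
  have h5 : √((6 * d ^ 2 : ℕ) : ℝ) ≤ 1 / 10 * r := by
    rw [Real.sqrt_le_left (by linarith)]
    push_cast
    nlinarith
  have h3' : (inc L M₁ : ℝ) ≤ 5 * d * (L.card + M₁.card) + k * M₁.card + L.card + inc L' M' := by
    exact_mod_cast h3
  have hM₁N : (M₁.card : ℝ) ≤ N := le_trans (by exact_mod_cast Finset.card_le_card hM₁) hMN'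
  have h6 : (5 * d * (L.card + M₁.card) : ℝ) ≤ 5 * (3 / 100 * r) * (N + N) := by gcongr
  have h7 : (k * M₁.card : ℝ) ≤ k * N := by gcongr
  have h8 : (N : ℝ) * 1000 ≤ N * r := by gcongr
  have h9 : ((6 * d ^ 2 : ℕ) : ℝ) * √((6 * d ^ 2 : ℕ) : ℝ) ≤ 1 / 100 * N * (1 / 10 * r) := by
    gcongr
    push_cast
    exact hd2
  have h10 : (k : ℝ) * ((6 * d ^ 2 : ℕ) : ℝ) ≤ k * (1 / 100 * N) := by
    gcongr
    push_cast
    exact hd2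
  linarith

/-- A projective transformation preserving incidences that makes all lines of a finite family
pairwise skew. -/
lemma exists_injOn_fst {K : Type*} [Field K] [Infinite K] (S : Finset (K × K × K)) :
    ∃ φ : K × K × K → K × K × K, (∀ u ∈ S, ∀ v ∈ S, Inc (φ u) (φ v) ↔ Inc u v) ∧
      Set.InjOn (fun u => (φ u).1) S := by
  obtain ⟨b, hb⟩ : ∃ b, (∏ w ∈ S.offDiag, (if w.1.1 = w.2.1 ∧ w.1.2.1 = w.2.2.1 then 1 else
      Polynomial.C (w.1.2.1 - w.2.2.1) * Polynomial.X + Polynomial.C (w.1.1 - w.2.1))).eval b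
        ≠ 0 := by
    refine exists_eval_ne_zero (Finset.prod_ne_zero_iff.2 fun w _ => ?_)
    split_ifs with h
    · exact one_ne_zero
    · intro hz
      have c0 := congrArg (fun P => Polynomial.coeff P 0) hz
      have c1 := congrArg (fun P => Polynomial.coeff P 1) hz
      simp [sub_eq_zero, Polynomial.coeff_C] at c0 c1
      exact h ⟨c0, c1⟩
  rw [Polynomial.eval_prod, Finset.prod_ne_zero_iff] at hb
  obtain ⟨t, ht⟩ : ∃ t, ((∏ u ∈ S, (Polynomial.C u.2.1 * Polynomial.X + 1)) *
      ∏ w ∈ S.offDiag, ((Polynomial.C w.1.2.2 * Polynomial.X +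
        Polynomial.C (w.1.1 + b * w.1.2.1)) * (Polynomial.C w.2.2.1 * Polynomial.X + 1) -
        (Polynomial.C w.2.2.2 * Polynomial.X +
        Polynomial.C (w.2.1 + b * w.2.2.1)) * (Polynomial.C w.1.2.1 * Polynomial.X + 1))).eval t
        ≠ 0 := by
    refine exists_eval_ne_zero (mul_ne_zero (Finset.prod_ne_zero_iff.2 fun u _ hz => ?_)
      (Finset.prod_ne_zero_iff.2 fun w hw hz => ?_))
    · simpa using congrArg (Polynomial.eval 0) hz
    · have h0 := congrArg (Polynomial.eval 0) hz
      have h1 := congrArg (fun P => Polynomial.eval 0 (Polynomial.derivative P)) hz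
      simp at h0 h1
      have h2 := hb w hw
      split_ifs at h2 with h
      · refine (Finset.mem_offDiag.1 hw).2.2 (Prod.ext h.1 (Prod.ext h.2 ?_))
        rw [h.1, h.2] at h1
        linear_combination h1
      · simp at h2
        apply h2
        linear_combination h0
  rw [Polynomial.eval_mul, Polynomial.eval_prod, Polynomial.eval_prod, mul_ne_zero_iff,
    Finset.prod_ne_zero_iff, Finset.prod_ne_zero_iff] at ht
  simp only [Polynomial.eval_add, Polynomial.eval_mul, Polynomial.eval_C, Polynomial.eval_X,
    Polynomial.eval_one, Polynomial.eval_sub] at ht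
  obtain ⟨ht1, ht2⟩ := ht
  refine ⟨fun u => ((u.1 + b * u.2.1 + t * u.2.2) / (u.2.1 * t + 1), u.2.1 / (u.2.1 * t + 1),
    u.2.2 / (u.2.1 * t + 1)), fun u hu v hv => ?_, fun u hu v hv huv => ?_⟩
  · have clear_denoms : ∀ d d' s s' x x' y y' : K, d ≠ 0 → d' ≠ 0 →
        (s / d * (x / d') + y / d = s' / d' * (x' / d) + y' / d' ↔
          s * x + y * d' = s' * x' + y' * d) := by
      intro d d' s s' x x' y y' hd hd'
      field_simp
    refine (clear_denoms _ _ _ _ _ _ _ _ (ht1 u hu) (ht1 v hv)).trans ?_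
    unfold Inc
    constructor <;> intro h <;> linear_combination h
  · by_contra hne
    have hw : (u, v) ∈ S.offDiag := Finset.mem_offDiag.2 ⟨hu, hv, hne⟩
    apply ht2 (u, v) hw
    linear_combination (div_eq_div_iff (ht1 u hu) (ht1 v hv)).1 huv

/-- The incidence bound for a single family of lines over an arbitrary field. -/
theorem inc_self_le (S : Finset (F × F × F)) (k : ℕ)
    (hk : ∀ m₁ ∈ S, ∀ m₂ ∈ S, m₁ ≠ m₂ → (S.filter fun l => Inc l m₁ ∧ Inc l m₂).card ≤ k)
    (hchar : ∀ j : ℕ, 0 < j → j * j ≤ S.card → (j : F) ≠ 0) :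
    (inc S S : ℝ) ≤ 20000 * (S.card * √S.card + k * S.card) := by
  let K := AlgebraicClosure F
  have : Infinite K := IsAlgClosed.instInfinite
  let ι : F → K := algebraMap F K
  have hι : Function.Injective ι := (algebraMap F K).injective
  let e : F × F × F → K × K × K := Prod.map ι (Prod.map ι ι)
  have he : Function.Injective e := hι.prodMap (hι.prodMap hι)
  have heInc : ∀ u v, Inc (e u) (e v) ↔ Inc u v := by
    intro u v
    simp only [Inc, e, Prod.map, ι]
    rw [← map_mul, ← map_add, ← map_mul, ← map_add, (algebraMap F K).injective.eq_iff]
  obtain ⟨φ, hφ, hφi⟩ := exists_injOn_fst (S.image e)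
  let g := φ ∘ e
  have hgInc : ∀ u ∈ S, ∀ v ∈ S, Inc (g u) (g v) ↔ Inc u v := fun u hu v hv =>
    (hφ _ (Finset.mem_image_of_mem e hu) _ (Finset.mem_image_of_mem e hv)).trans (heInc u v)
  have hgfst : ∀ u ∈ S, ∀ v ∈ S, (g u).1 = (g v).1 → u = v := fun u hu v hv h =>
    he (hφi (Finset.mem_image_of_mem e hu) (Finset.mem_image_of_mem e hv) h)
  have hginj : Set.InjOn g S := fun u hu v hv h => hgfst u hu v hv (congrArg Prod.fst h)
  have hcard : (S.image g).card = S.card := Finset.card_image_of_injOn hginj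
  have himg : Set.InjOn Prod.fst (S.image g : Set (K × K × K)) := by
    intro u hu v hv h
    obtain ⟨u, hu', rfl⟩ := Finset.mem_image.1 (Finset.mem_coe.1 hu)
    obtain ⟨v, hv', rfl⟩ := Finset.mem_image.1 (Finset.mem_coe.1 hv)
    rw [hgfst u hu' v hv' h]
  have h1 : inc S S ≤ inc (S.image g) (S.image g) := by
    refine Finset.card_le_card_of_injOn (Prod.map g g) ?_ ?_
    · rintro ⟨u, v⟩ h
      simp only [Finset.coe_filter, Finset.mem_product, Set.mem_ofPred_eq] at h ⊢
      exact ⟨⟨Finset.mem_image_of_mem g h.1.1, Finset.mem_image_of_mem g h.1.2⟩,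
        (hgInc u h.1.1 v h.1.2).2 h.2⟩
    · rintro ⟨u, v⟩ h ⟨u', v'⟩ h' huv
      simp only [Finset.coe_filter, Finset.mem_product, Set.mem_ofPred_eq] at h h'
      exact Prod.ext (hginj h.1.1 h'.1.1 (congrArg Prod.fst huv))
        (hginj h.1.2 h'.1.2 (congrArg Prod.snd huv))
  have h2 := inc_le k S.card (S.image g) (S.image g) hcard.le hcard.le himg himg ?_ ?_
  · exact le_trans (by exact_mod_cast h1) h2
  · intro m₁ hm₁ m₂ hm₂ hne
    obtain ⟨m₁, hS₁, rfl⟩ := Finset.mem_image.1 hm₁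
    obtain ⟨m₂, hS₂, rfl⟩ := Finset.mem_image.1 hm₂
    refine le_trans ?_ (hk m₁ hS₁ m₂ hS₂ fun h => hne (congrArg g h))
    refine le_trans (Finset.card_le_card ?_) (Finset.card_image_le (f := g))
    intro l hl
    obtain ⟨hl, hl1, hl2⟩ := Finset.mem_filter.1 hl
    obtain ⟨l, hlS, rfl⟩ := Finset.mem_image.1 hl
    exact Finset.mem_image_of_mem g (Finset.mem_filter.2
      ⟨hlS, (hgInc l hlS m₁ hS₁).1 hl1, (hgInc l hlS m₂ hS₂).1 hl2⟩)
  · intro j hj hjN h0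
    apply hchar j hj hjN
    apply (algebraMap F K).injective
    simpa using h0

/-- Two elements of `A × L`, viewed as lines in space, have few common transversals in `A × L`. -/
lemma card_common_le {A : Finset F} {L : Finset (F × F)} {k : ℕ}
    (hA : A.card ≤ k)
    (hL : ∀ q : F × F, (L.filter fun l => q.2 = l.1 * q.1 + l.2).card ≤ k)
    {m₁ m₂ : F × F × F} (hne : m₁ ≠ m₂) :
    ((A ×ˢ L).filter fun l => Inc l m₁ ∧ Inc l m₂).card ≤ k := by
  set T := (A ×ˢ L).filter fun l => Inc l m₁ ∧ Inc l m₂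
  have hT : ∀ l ∈ T, l.1 ∈ A ∧ l.2 ∈ L ∧ l.2.1 * m₁.1 + l.2.2 = m₁.2.1 * l.1 + m₁.2.2 ∧
      l.2.1 * m₂.1 + l.2.2 = m₂.2.1 * l.1 + m₂.2.2 := by
    intro l hl
    have h := Finset.mem_filter.1 hl
    exact ⟨(Finset.mem_product.1 h.1).1, (Finset.mem_product.1 h.1).2, h.2.1, h.2.2⟩
  by_cases hc : m₁.1 = m₂.1
  · rcases T.eq_empty_or_nonempty with h | ⟨l₀, h₀⟩
    · simp [h]
    obtain ⟨-, -, a1, a2⟩ := hT l₀ h₀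
    have hs : m₁.2.1 - m₂.2.1 ≠ 0 := by
      intro h
      have h := sub_eq_zero.1 h
      refine hne (Prod.ext hc (Prod.ext h ?_))
      rw [hc, h] at a1
      linear_combination a2 - a1
    have hx : ∀ l ∈ T, l.1 = l₀.1 := by
      intro l hl
      obtain ⟨-, -, b1, b2⟩ := hT l hl
      rw [hc] at a1 b1
      apply mul_left_cancel₀ hs
      linear_combination b2 - b1 + a1 - a2
    refine le_trans ?_ (hL (m₁.1, m₁.2.1 * l₀.1 + m₁.2.2))
    refine Finset.card_le_card_of_injOn Prod.snd ?_ ?_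
    · intro l hl
      obtain ⟨-, hlL, b1, -⟩ := hT l hl
      rw [hx l hl] at b1
      exact Finset.mem_filter.2 ⟨hlL, b1.symm⟩
    · intro l hl l' hl' h
      exact Prod.ext ((hx l hl).trans (hx l' hl').symm) h
  · refine le_trans (Finset.card_le_card_of_injOn Prod.fst (fun l hl => (hT l hl).1) ?_) hA
    intro l hl l' hl' h
    obtain ⟨-, -, a1, a2⟩ := hT l hl
    obtain ⟨-, -, b1, b2⟩ := hT l' hl'
    replace h : l.1 = l'.1 := h
    rw [h] at a1 a2
    have hs : l.2.1 = l'.2.1 := by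
      apply mul_right_cancel₀ (sub_ne_zero.2 hc)
      linear_combination a1 - a2 - b1 + b2
    rw [hs] at a1
    exact Prod.ext h (Prod.ext hs (by linear_combination a1 - b1))

end LineIncidence

open LineIncidence

theorem stmt_15 :
    ∃ c C : ℝ, 0 < c ∧ 0 < C ∧
      ∀ (F : Type) [Field F] (A : Finset F) (a : ℕ),
        -- `L` is a finite set of non-vertical lines, each represented by its
        -- (slope, intercept) pair `(s_ℓ, t_ℓ)`; distinct lines have distinct pairs.
        ∀ (L : Finset (F × F)) (n : ℕ),
        A.card = a → L.card = n → a ≤ n →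
        -- at most `a^{1/2} n^{1/2}` lines of `L` pass through any common point
        (∀ q : F × F,
          (Set.ncard {ℓ : F × F | ℓ ∈ L ∧ q.2 = ℓ.1 * q.1 + ℓ.2} : ℝ) ≤
            (a : ℝ) ^ ((1 : ℝ) / 2) * (n : ℝ) ^ ((1 : ℝ) / 2)) →
        -- at most `a^{1/2} n^{1/2}` lines of `L` share any common slope
        (∀ s : F,
          (Set.ncard {ℓ : F × F | ℓ ∈ L ∧ ℓ.1 = s} : ℝ) ≤
            (a : ℝ) ^ ((1 : ℝ) / 2) * (n : ℝ) ^ ((1 : ℝ) / 2)) →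
        (∀ p : ℕ, p.Prime → CharP F p → (a * n : ℝ) ≤ c * (p : ℝ) ^ 2) →
        (Set.ncard {q : (F × (F × F)) × (F × (F × F)) |
            q.1.1 ∈ A ∧ q.1.2 ∈ L ∧ q.2.1 ∈ A ∧ q.2.2 ∈ L ∧
            q.1.1 * q.1.2.1 + q.1.2.2 = q.2.1 * q.2.2.1 + q.2.2.2} : ℝ) ≤
          C * (a : ℝ) ^ ((3 : ℝ) / 2) * (n : ℝ) ^ ((3 : ℝ) / 2) := by
  refine ⟨1 / 2, 40000, by norm_num, by norm_num, ?_⟩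
  intro F _ A a L n hA hL han hpt _ hp
  have hpow : ∀ x : ℕ, (x : ℝ) ^ ((3 : ℝ) / 2) = x * √x := by
    intro x
    rw [show (3 : ℝ) / 2 = 1 + 1 / 2 by norm_num, Real.rpow_add_of_nonneg (Nat.cast_nonneg _)
      (by norm_num) (by norm_num), Real.rpow_one, Real.sqrt_eq_rpow]
  simp only [← Real.sqrt_eq_rpow] at hpt
  rw [hpow, hpow]
  set B := √(a : ℝ) * √(n : ℝ)
  have hB0 : 0 ≤ B := by positivity
  have hcard : (A ×ˢ L).card = a * n := by rw [Finset.card_product, hA, hL]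
  have hAk : A.card ≤ ⌊B⌋₊ := by
    refine Nat.le_floor ?_
    rw [hA]
    calc (a : ℝ) = √(a : ℝ) * √(a : ℝ) := (Real.mul_self_sqrt (Nat.cast_nonneg _)).symm
      _ ≤ B := by
        refine mul_le_mul_of_nonneg_left (Real.sqrt_le_sqrt ?_) (Real.sqrt_nonneg _)
        exact_mod_cast han
  have hLk : ∀ q : F × F, (L.filter fun l => q.2 = l.1 * q.1 + l.2).card ≤ ⌊B⌋₊ := by
    intro q
    refine Nat.le_floor (le_trans (le_of_eq ?_) (hpt q))
    rw [← Set.ncard_coe_finset, Finset.coe_filter]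
  have hmain := inc_self_le (A ×ˢ L) ⌊B⌋₊ (fun m₁ _ m₂ _ hne => card_common_le hAk hLk hne) (by
    intro j hj hjN h0
    obtain ⟨p, hchar⟩ := CharP.exists F
    have hpj : p ∣ j := (CharP.cast_eq_zero_iff F p j).1 h0
    have hp0 : p ≠ 0 := by
      rintro rfl
      exact hj.ne' (zero_dvd_iff.1 hpj)
    have h1 := hp p ((CharP.char_is_prime_or_zero F p).resolve_right hp0) hchar
    have h2 : p ≤ j := Nat.le_of_dvd hj hpj
    have h3 : p * p ≤ a * n := (Nat.mul_le_mul h2 h2).trans (hcard ▸ hjN)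
    have h4 : (p * p : ℝ) ≤ a * n := by exact_mod_cast h3
    have h5 : (0 : ℝ) < p := by exact_mod_cast Nat.pos_of_ne_zero hp0
    nlinarith)
  have hquad : Set.ncard {q : (F × (F × F)) × (F × (F × F)) |
      q.1.1 ∈ A ∧ q.1.2 ∈ L ∧ q.2.1 ∈ A ∧ q.2.2 ∈ L ∧
      q.1.1 * q.1.2.1 + q.1.2.2 = q.2.1 * q.2.2.1 + q.2.2.2} ≤ inc (A ×ˢ L) (A ×ˢ L) := by
    rw [inc, ← Set.ncard_coe_finset]
    refine Set.ncard_le_ncard_of_injOn (fun q => ((q.2.1, q.1.2), (q.1.1, q.2.2))) ?_ ?_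
      (Finset.finite_toSet _)
    · rintro ⟨⟨x, l⟩, ⟨x', l'⟩⟩ ⟨h1, h2, h3, h4, h5⟩
      simp only [Finset.coe_filter, Finset.mem_product, Set.mem_ofPred_eq]
      refine ⟨⟨⟨h3, h2⟩, h1, h4⟩, ?_⟩
      simp only [Inc] at h5 ⊢
      linear_combination h5
    · rintro ⟨⟨x, l⟩, ⟨x', l'⟩⟩ _ ⟨⟨y, r⟩, ⟨y', r'⟩⟩ _ h
      simp only [Prod.mk.injEq] at h ⊢
      tauto
  have hfl : (⌊B⌋₊ : ℝ) ≤ B := Nat.floor_le hB0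
  have hq : (Set.ncard {q : (F × (F × F)) × (F × (F × F)) |
      q.1.1 ∈ A ∧ q.1.2 ∈ L ∧ q.2.1 ∈ A ∧ q.2.2 ∈ L ∧
      q.1.1 * q.1.2.1 + q.1.2.2 = q.2.1 * q.2.2.1 + q.2.2.2} : ℝ) ≤ inc (A ×ˢ L) (A ×ˢ L) := by
    exact_mod_cast hquad
  refine (hq.trans hmain).trans ?_
  rw [hcard]
  push_cast
  rw [Real.sqrt_mul (Nat.cast_nonneg _)]
  have h6 : (⌊B⌋₊ : ℝ) * (a * n) ≤ B * (a * n) := by gcongr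
  calc 20000 * ((a * n : ℝ) * B + ⌊B⌋₊ * (a * n)) ≤ 20000 * ((a * n : ℝ) * B + B * (a * n)) := by
        gcongr
    _ = 40000 * (a * √a) * (n * √n) := by simp only [B]; ring
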